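/- arXiv:1903.09877 — 3 statements merged into one kernel-verified Lean document; each statement's English description precedes it below -/
import Mathlib

section
/- Fix an integer b ≥ 2. For every x ∈ [0,1] and every i ∈ ℕ, V_i(x,1) = V_i(1,x) = x·(b−1)/b^{i+1}. In particular V_i(1,1), which equals the Lebesgue measure of D_i, is (b−1)/b^{i+1}. -/
open MeasureTheory
open scoped Classical

noncomputable def gammaB (b : ℕ) (x y : ℝ) : ℕ∞ :=
  if x = y then ⊤
  else (↑(sInf {i : ℕ | ⌊(b : ℝ) ^ i * x⌋ = ⌊(b : ℝ) ^ i * y⌋ ∧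
      ⌊(b : ℝ) ^ (i + 1) * x⌋ ≠ ⌊(b : ℝ) ^ (i + 1) * y⌋}) : ℕ∞)

def Dset (b : ℕ) (i : ℕ) : Set (ℝ × ℝ) :=
  {p | p.1 ∈ Set.Ico (0 : ℝ) 1 ∧ p.2 ∈ Set.Ico (0 : ℝ) 1 ∧ gammaB b p.1 p.2 = (i : ℕ∞)}

noncomputable def Vi (b : ℕ) (i : ℕ) (x y : ℝ) : ℝ :=
  (volume ((Set.Ico (0 : ℝ) x ×ˢ Set.Ico (0 : ℝ) y) ∩ Dset b i)).toReal

lemma aux_floor_step (b : ℕ) (hb : 2 ≤ b) (u v : ℝ) (j : ℕ)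
    (h : ⌊(b : ℝ) ^ (j + 1) * u⌋ = ⌊(b : ℝ) ^ (j + 1) * v⌋) :
    ⌊(b : ℝ) ^ j * u⌋ = ⌊(b : ℝ) ^ j * v⌋ := by
  have hb0 : (0 : ℝ) < b := by positivity
  have key : ∀ (z : ℝ) (n : ℤ), n ≤ ⌊(b : ℝ) ^ j * z⌋ ↔ (b : ℤ) * n ≤ ⌊(b : ℝ) ^ (j + 1) * z⌋ := by
    intro z n
    rw [Int.le_floor, Int.le_floor]
    push_cast
    rw [pow_succ', mul_assoc, mul_le_mul_iff_right₀ hb0]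
  apply le_antisymm
  · rw [key, ← h, ← key]
  · rw [key, h, ← key]

lemma aux_floor_le (b : ℕ) (hb : 2 ≤ b) (u v : ℝ) (m j : ℕ) (hmj : m ≤ j)
    (h : ⌊(b : ℝ) ^ j * u⌋ = ⌊(b : ℝ) ^ j * v⌋) :
    ⌊(b : ℝ) ^ m * u⌋ = ⌊(b : ℝ) ^ m * v⌋ := by
  induction j, hmj using Nat.le_induction with
  | base => exact h
  | succ k _ ih => exact ih (aux_floor_step b hb u v k h)

lemma aux_exists_ne (b : ℕ) (hb : 2 ≤ b) (u v : ℝ) (huv : u ≠ v) :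
    ∃ j : ℕ, ⌊(b : ℝ) ^ j * u⌋ ≠ ⌊(b : ℝ) ^ j * v⌋ := by
  have hb1 : (1 : ℝ) < b := by exact_mod_cast (by omega : 1 < b)
  have hpos : 0 < |u - v| := abs_pos.mpr (sub_ne_zero.mpr huv)
  obtain ⟨j, hj⟩ := pow_unbounded_of_one_lt (1 / |u - v|) hb1
  refine ⟨j, fun h => ?_⟩
  have h1 := Int.abs_sub_lt_one_of_floor_eq_floor h
  rw [← mul_sub, abs_mul, abs_of_pos (by positivity)] at h1
  rw [div_lt_iff₀ hpos] at hj
  linarith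

lemma aux_gamma (b : ℕ) (hb : 2 ≤ b) (u v : ℝ) (hu : u ∈ Set.Ico (0 : ℝ) 1)
    (hv : v ∈ Set.Ico (0 : ℝ) 1) (i : ℕ) :
    gammaB b u v = (i : ℕ∞) ↔ (⌊(b : ℝ) ^ i * u⌋ = ⌊(b : ℝ) ^ i * v⌋ ∧
      ⌊(b : ℝ) ^ (i + 1) * u⌋ ≠ ⌊(b : ℝ) ^ (i + 1) * v⌋) := by
  unfold gammaB
  by_cases huv : u = v
  · subst huv
    simp
  · rw [if_neg huv]
    set S := {i : ℕ | ⌊(b : ℝ) ^ i * u⌋ = ⌊(b : ℝ) ^ i * v⌋ ∧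
      ⌊(b : ℝ) ^ (i + 1) * u⌋ ≠ ⌊(b : ℝ) ^ (i + 1) * v⌋} with hS
    have hne : S.Nonempty := by
      have hex := aux_exists_ne b hb u v huv
      have h1 := Nat.find_spec hex
      have h2 := fun m => Nat.find_min (m := m) hex
      set n := Nat.find hex
      rcases Nat.eq_zero_or_eq_succ_pred n with h0 | h0
      · exfalso
        rw [h0] at h1
        apply h1
        simp only [pow_zero, one_mul]
        rw [Int.floor_eq_zero_iff.mpr hu, Int.floor_eq_zero_iff.mpr hv]
      · refine ⟨n.pred, ?_, ?_⟩
        · exact not_not.mp (h2 n.pred (by omega))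
        · rw [h0] at h1
          exact h1
    have hmem := Nat.sInf_mem hne
    rw [Nat.cast_inj]
    constructor
    · intro h
      rw [h] at hmem
      exact hmem
    · intro h
      apply le_antisymm
      · exact Nat.sInf_le h
      · by_contra! hlt
        exact hmem.2 (aux_floor_le b hb u v _ i hlt h.1)

lemma aux_cell (b : ℕ) (hb : 2 ≤ b) (k : ℤ) (j : ℕ) :
    {v : ℝ | k = ⌊(b : ℝ) ^ j * v⌋} =
      Set.Ico ((k : ℝ) / (b : ℝ) ^ j) (((k : ℝ) + 1) / (b : ℝ) ^ j) := by
  have hp : (0 : ℝ) < (b : ℝ) ^ j := by positivity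
  ext v
  simp only [Set.mem_ofPred_eq, Set.mem_Ico]
  rw [eq_comm, Int.floor_eq_iff, div_le_iff₀ hp, lt_div_iff₀ hp, mul_comm v]

lemma aux_cell_volume (b : ℕ) (hb : 2 ≤ b) (k : ℤ) (j : ℕ) :
    volume {v : ℝ | k = ⌊(b : ℝ) ^ j * v⌋} = ENNReal.ofReal (1 / (b : ℝ) ^ j) := by
  rw [aux_cell b hb, Real.volume_Ico]
  congr 1
  ring

lemma aux_slice_volume (b : ℕ) (hb : 2 ≤ b) (u : ℝ) (hu : u ∈ Set.Ico (0 : ℝ) 1) (i : ℕ) :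
    volume {v : ℝ | v ∈ Set.Ico (0 : ℝ) 1 ∧ ⌊(b : ℝ) ^ i * u⌋ = ⌊(b : ℝ) ^ i * v⌋ ∧
      ⌊(b : ℝ) ^ (i + 1) * u⌋ ≠ ⌊(b : ℝ) ^ (i + 1) * v⌋} =
      ENNReal.ofReal (((b : ℝ) - 1) / (b : ℝ) ^ (i + 1)) := by
  have hb0 : (0 : ℝ) < b := by positivity
  have heq : {v : ℝ | v ∈ Set.Ico (0 : ℝ) 1 ∧ ⌊(b : ℝ) ^ i * u⌋ = ⌊(b : ℝ) ^ i * v⌋ ∧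
      ⌊(b : ℝ) ^ (i + 1) * u⌋ ≠ ⌊(b : ℝ) ^ (i + 1) * v⌋} =
      {v : ℝ | ⌊(b : ℝ) ^ i * u⌋ = ⌊(b : ℝ) ^ i * v⌋} \
      {v : ℝ | ⌊(b : ℝ) ^ (i + 1) * u⌋ = ⌊(b : ℝ) ^ (i + 1) * v⌋} := by
    ext v
    simp only [Set.mem_ofPred_eq, Set.mem_sdiff]
    constructor
    · exact fun h => h.2
    · intro h
      refine ⟨?_, h⟩
      have h0 := aux_floor_le b hb u v 0 i (Nat.zero_le _) h.1
      simp only [pow_zero, one_mul] at h0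
      rw [Int.floor_eq_zero_iff.mpr hu] at h0
      exact Int.floor_eq_zero_iff.mp h0.symm
  rw [heq, measure_sdiff, aux_cell_volume b hb, aux_cell_volume b hb,
    ← ENNReal.ofReal_sub _ (by positivity)]
  · congr 1
    field_simp
    ring
  · intro v hv
    exact aux_floor_step b hb u v i hv
  · rw [aux_cell b hb]
    exact measurableSet_Ico.nullMeasurableSet
  · rw [aux_cell_volume b hb]
    exact ENNReal.ofReal_ne_top

lemma aux_Dset (b : ℕ) (hb : 2 ≤ b) (i : ℕ) :
    Dset b i = {p : ℝ × ℝ | p.1 ∈ Set.Ico (0 : ℝ) 1 ∧ p.2 ∈ Set.Ico (0 : ℝ) 1 ∧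
      (⌊(b : ℝ) ^ i * p.1⌋ = ⌊(b : ℝ) ^ i * p.2⌋ ∧
      ⌊(b : ℝ) ^ (i + 1) * p.1⌋ ≠ ⌊(b : ℝ) ^ (i + 1) * p.2⌋)} := by
  ext p
  unfold Dset
  simp only [Set.mem_ofPred_eq]
  constructor
  · rintro ⟨h1, h2, h3⟩
    exact ⟨h1, h2, (aux_gamma b hb _ _ h1 h2 i).mp h3⟩
  · rintro ⟨h1, h2, h3⟩
    exact ⟨h1, h2, (aux_gamma b hb _ _ h1 h2 i).mpr h3⟩

lemma aux_measurable (b : ℕ) (hb : 2 ≤ b) (i : ℕ) : MeasurableSet (Dset b i) := by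
  rw [aux_Dset b hb]
  have hf : ∀ j : ℕ, MeasurableSet {p : ℝ × ℝ | ⌊(b : ℝ) ^ j * p.1⌋ = ⌊(b : ℝ) ^ j * p.2⌋} := by
    intro j
    exact measurableSet_eq_fun (by fun_prop) (by fun_prop)
  exact (measurable_fst measurableSet_Ico).inter
    ((measurable_snd measurableSet_Ico).inter ((hf i).inter (hf (i + 1)).compl))

lemma aux_V_left (b : ℕ) (hb : 2 ≤ b) (x : ℝ) (hx : x ∈ Set.Icc (0 : ℝ) 1) (i : ℕ) :
    Vi b i x 1 = x * ((b : ℝ) - 1) / (b : ℝ) ^ (i + 1) := by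
  have hb1 : (0 : ℝ) ≤ (b : ℝ) - 1 := by
    have : (2 : ℝ) ≤ b := by exact_mod_cast hb
    linarith
  unfold Vi
  rw [Measure.volume_eq_prod, Measure.prod_apply
    ((measurableSet_Ico.prod measurableSet_Ico).inter (aux_measurable b hb i))]
  have : ∀ u : ℝ, volume (Prod.mk u ⁻¹' (Set.Ico (0 : ℝ) x ×ˢ Set.Ico (0 : ℝ) 1 ∩ Dset b i)) =
      (Set.Ico (0 : ℝ) x).indicator
        (fun _ => ENNReal.ofReal (((b : ℝ) - 1) / (b : ℝ) ^ (i + 1))) u := by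
    intro u
    by_cases hu : u ∈ Set.Ico (0 : ℝ) x
    · have hu1 : u ∈ Set.Ico (0 : ℝ) 1 := ⟨hu.1, hu.2.trans_le hx.2⟩
      rw [Set.indicator_of_mem hu, ← aux_slice_volume b hb u hu1 i, aux_Dset b hb]
      congr 1
      ext v
      simp only [Set.mem_preimage, Set.mem_inter_iff, Set.mem_prod, Set.mem_ofPred_eq]
      tauto
    · rw [Set.indicator_of_notMem hu]
      convert measure_empty (μ := (volume : Measure ℝ))
      ext v
      simp only [Set.mem_preimage, Set.mem_inter_iff, Set.mem_prod, Set.mem_empty_iff_false]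
      tauto
  simp_rw [this]
  rw [lintegral_indicator measurableSet_Ico, setLIntegral_const, Real.volume_Ico,
    ENNReal.toReal_mul, ENNReal.toReal_ofReal (by positivity),
    ENNReal.toReal_ofReal (by linarith [hx.1])]
  ring

lemma aux_V_symm (b : ℕ) (hb : 2 ≤ b) (x y : ℝ) (i : ℕ) : Vi b i x y = Vi b i y x := by
  unfold Vi
  have hm := (measurableSet_Ico (a := (0 : ℝ)) (b := y)).prod
    (measurableSet_Ico (a := (0 : ℝ)) (b := x)) |>.inter (aux_measurable b hb i)
  have hs : MeasurePreserving (Prod.swap : ℝ × ℝ → ℝ × ℝ) volume volume :=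
    Measure.measurePreserving_swap
  rw [← hs.measure_preimage hm.nullMeasurableSet]
  congr 2
  rw [aux_Dset b hb]
  ext p
  simp only [Set.mem_preimage, Set.mem_inter_iff, Set.mem_prod, Set.mem_ofPred_eq,
    Prod.fst_swap, Prod.snd_swap, ne_eq, eq_comm (a := ⌊(b : ℝ) ^ i * p.1⌋),
    eq_comm (a := ⌊(b : ℝ) ^ (i + 1) * p.1⌋)]
  tauto

theorem stmt1 (b : ℕ) (hb : 2 ≤ b) (x : ℝ) (hx : x ∈ Set.Icc (0 : ℝ) 1) (i : ℕ) :
    Vi b i x 1 = x * ((b : ℝ) - 1) / (b : ℝ) ^ (i + 1) ∧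
    Vi b i 1 x = x * ((b : ℝ) - 1) / (b : ℝ) ^ (i + 1) ∧
    (volume (Dset b i)).toReal = ((b : ℝ) - 1) / (b : ℝ) ^ (i + 1) := by
  refine ⟨aux_V_left b hb x hx i, ?_, ?_⟩
  · rw [aux_V_symm b hb, aux_V_left b hb x hx i]
  · have h := aux_V_left b hb 1 ⟨zero_le_one, le_rfl⟩ i
    rw [one_mul] at h
    rw [← h]
    unfold Vi
    congr 2
    ext p
    simp only [Set.mem_inter_iff, Set.mem_prod]
    constructor
    · exact fun hp => ⟨⟨hp.1, hp.2.1⟩, hp⟩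
    · exact fun hp => hp.2
end

section
/- Fix an integer b ≥ 2 and s ≥ 1, and let x, y ∈ [0,1]^s. For j = 1,…,s define t_{j,0} = b·V_0(x_j,y_j)/(b−1) and t_{j,k} = (b·V_k(x_j,y_j) − V_{k−1}(x_j,y_j))/(b−1) for k ≥ 1, and for k ∈ ℕ^s set t_k = ∏_{j=1}^s t_{j,k_j}. Then: (a) t_k ≥ 0 for every k ∈ ℕ^s; (b) for every i ∈ ℕ^s, V^s_i(x,y) = Σ_{k ∈ ℕ^s, k_j ≤ i_j ∀j} t_k · (b−1)^s / b^{s+|i−k|}; and (c) the series Σ_{k ∈ ℕ^s} t_k converges with sum equal to ∏_{j=1}^s x_j·y_j, the volume of R(x,y). -/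
open MeasureTheory
open scoped Classical

def DsetS (b s : ℕ) (i : Fin s → ℕ) : Set ((Fin s → ℝ) × (Fin s → ℝ)) :=
  {p | (∀ j, p.1 j ∈ Set.Ico (0 : ℝ) 1) ∧ (∀ j, p.2 j ∈ Set.Ico (0 : ℝ) 1) ∧
    ∀ j, gammaB b (p.1 j) (p.2 j) = (i j : ℕ∞)}

def Rset (s : ℕ) (x y : Fin s → ℝ) : Set ((Fin s → ℝ) × (Fin s → ℝ)) :=
  (Set.univ.pi fun j => Set.Ico 0 (x j)) ×ˢ (Set.univ.pi fun j => Set.Ico 0 (y j))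

noncomputable def ViS (b s : ℕ) (i : Fin s → ℕ) (x y : Fin s → ℝ) : ℝ :=
  (volume (Rset s x y ∩ DsetS b s i)).toReal

noncomputable def tCoef (b : ℕ) (x y : ℝ) : ℕ → ℝ
  | 0 => (b : ℝ) * Vi b 0 x y / ((b : ℝ) - 1)
  | (k + 1) => ((b : ℝ) * Vi b (k + 1) x y - Vi b k x y) / ((b : ℝ) - 1)

/-- next-step inequality -/
theorem step_ineq (b A c d p q : ℝ) (hb : 2 ≤ b) (hc0 : 0 ≤ c) (hc : c ≤ b - 2 ∨ c = b - 1)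
    (hd : d ≤ b - 2 ∨ d = b - 1) (hd0 : d = 0 ∨ 1 ≤ d)
    (hpq : p ≤ q) (hq : q ≤ 1) (p' q' p'' q'' : ℝ)
    (hp' : p' = b * p - c) (hp'' : p'' = b * p' - d) (h0 : 0 ≤ p) (h0' : 0 ≤ p') (h0'' : 0 ≤ p'')
    (h1' : p' < 1) (h1'' : p'' < 1)
    (hq' : q' = min (b * q - c) 1) (hq'' : q'' = min (b * q' - d) 1) :
    0 ≤ b * ((b * A + c + p' * q') / b ^ 2 - (b * (b * A + c) + d + p'' * q'') / b ^ 4)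
      - ((A + p * q) - (b * A + c + p' * q') / b ^ 2) := by
  have hbpos : 0 < b := by linarith
  have key : b * ((b * A + c + p' * q') / b ^ 2 - (b * (b * A + c) + d + p'' * q'') / b ^ 4)
      - ((A + p * q) - (b * A + c + p' * q') / b ^ 2)
      = (b ^ 2 * (c + p' * q') + b * (c + p' * q') - (b * c + d + p'' * q'') - b ^ 3 * (p * q)) / b ^ 3 := by
    field_simp
    ring
  rw [key]
  apply div_nonneg _ (by positivity)
  have hp : p = (c + p') / b := by rw [hp']; field_simp; ring
  have hdb : d ≤ b - 1 := by rcases hd with h | h <;> linarith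
  have hcb : c ≤ b - 1 := by rcases hc with h | h <;> linarith
  have hd0'' : 0 ≤ d := by rcases hd0 with h | h <;> linarith
  rcases le_total 1 (b * q - c) with h | h
  · rw [min_eq_right h] at hq'
    subst hq'
    rw [min_eq_right (by linarith)] at hq''
    subst hq''
    have : b ^ 2 * (c + p' * 1) + b * (c + p' * 1) - (b * c + d + p'' * 1) - b ^ 3 * (p * q)
      = b ^ 3 * (p * (1 - q)) := by
      subst hp''; subst hp'; ring
    rw [this]
    have := mul_nonneg h0 (sub_nonneg.2 hq)
    positivity
  · rw [min_eq_left h] at hq'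
    have hqq : q = (c + q') / b := by rw [hq']; field_simp; ring
    have hq1 : q' ≤ 1 := by linarith
    have hpq' : p' ≤ q' := by rw [hp', hq']; nlinarith
    rcases le_total 1 (b * q' - d) with h2 | h2
    · rw [min_eq_right h2] at hq''
      subst hq''
      have : b ^ 2 * (c + p' * q') + b * (c + p' * q') - (b * c + d + p'' * 1) - b ^ 3 * (p * q)
        = b * (c * (b - c - p' - q') + p' * (b * q' - 1)) := by
        rw [hp, hqq, hp'']; field_simp; ring
      rw [this]
      apply mul_nonneg hbpos.le
      rcases hc with hc | hc
      · have := mul_nonneg hc0 (show 0 ≤ b - c - p' - q' by linarith)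
        have := mul_nonneg h0' (show 0 ≤ b * q' - 1 by linarith)
        linarith
      · have e : c * (b - c - p' - q') + p' * (b * q' - 1) = (1 - q') * (b - 1 - b * p') := by
          rw [hc]; ring
        rw [e]
        rcases hd with hd | hd
        · apply mul_nonneg <;> linarith
        · have : q' = 1 := by
            apply le_antisymm hq1
            by_contra hh
            push Not at hh
            nlinarith
          rw [this]; simp
    · rw [min_eq_left h2] at hq''
      have hpq'' : p'' ≤ q'' := by rw [hp'', hq'']; nlinarith
      have ep : p' = (d + p'') / b := by rw [hp'']; field_simp; ring
      have eq : q' = (d + q'') / b := by rw [hq'']; field_simp; ring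
      have : b ^ 2 * (c + p' * q') + b * (c + p' * q') - (b * c + d + p'' * q'') - b ^ 3 * (p * q)
        = b * (c * (b - c - p' - q')) + (d * (d - 1) + d * (p'' + q'')) := by
        rw [hp, hqq, ep, eq]; field_simp; ring
      rw [this]
      have hdd : 0 ≤ d * (d - 1) := by
        rcases hd0 with h | h
        · rw [h]; simp
        · apply mul_nonneg <;> linarith
      have hds : 0 ≤ d * (p'' + q'') := mul_nonneg hd0'' (by linarith)
      rcases hc with hc | hc
      · have := mul_nonneg hbpos.le (mul_nonneg hc0 (show 0 ≤ b - c - p' - q' by linarith))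
        linarith
      · have e : b * (c * (b - c - p' - q')) + (d * (d - 1) + d * (p'' + q''))
          = (b - 1 - d) * (b - d - (p'' + q'')) := by
          rw [hc, ep, eq]; field_simp; ring
        rw [e]
        rcases hd with hd | hd
        · apply mul_nonneg <;> linarith
        · rw [hd]; simp

theorem floor_anti (b : ℕ) (hb : 2 ≤ b) (u v : ℝ) {i j : ℕ} (hij : i ≤ j)
    (h : ⌊(b : ℝ) ^ j * u⌋ = ⌊(b : ℝ) ^ j * v⌋) : ⌊(b : ℝ) ^ i * u⌋ = ⌊(b : ℝ) ^ i * v⌋ := by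
  obtain ⟨k, rfl⟩ := Nat.exists_eq_add_of_le hij
  have hb0 : (b : ℝ) ≠ 0 := by positivity
  have key : ∀ w : ℝ, ⌊(b : ℝ) ^ i * w⌋ = ⌊(b : ℝ) ^ (i + k) * w⌋ / ((b ^ k : ℕ) : ℤ) := by
    intro w
    rw [← Int.floor_div_natCast]
    congr 1
    push_cast
    field_simp
    ring
  rw [key, key, h]

theorem gammaB_eq_iff (b : ℕ) (hb : 2 ≤ b) (u v : ℝ) (hu : u ∈ Set.Ico (0 : ℝ) 1)
    (hv : v ∈ Set.Ico (0 : ℝ) 1) (i : ℕ) :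
    gammaB b u v = (i : ℕ∞) ↔ ⌊(b : ℝ) ^ i * u⌋ = ⌊(b : ℝ) ^ i * v⌋ ∧
      ⌊(b : ℝ) ^ (i + 1) * u⌋ ≠ ⌊(b : ℝ) ^ (i + 1) * v⌋ := by
  unfold gammaB
  constructor
  · intro h
    split_ifs at h with huv
    · simp at h
    · rw [Nat.cast_inj] at h
      have hne : {i : ℕ | ⌊(b : ℝ) ^ i * u⌋ = ⌊(b : ℝ) ^ i * v⌋ ∧
          ⌊(b : ℝ) ^ (i + 1) * u⌋ ≠ ⌊(b : ℝ) ^ (i + 1) * v⌋}.Nonempty := by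
        by_contra hemp
        have hall : ∀ n : ℕ, ⌊(b : ℝ) ^ n * u⌋ = ⌊(b : ℝ) ^ n * v⌋ := by
          intro n
          induction n with
          | zero =>
            simp only [pow_zero, one_mul]
            rw [Int.floor_eq_zero_iff.2 hu, Int.floor_eq_zero_iff.2 hv]
          | succ n ih =>
            by_contra hcon
            exact hemp ⟨n, ih, hcon⟩
        have habs : 0 < |u - v| := abs_pos.2 (sub_ne_zero.2 huv)
        obtain ⟨n, hn⟩ := pow_unbounded_of_one_lt (1 / |u - v|)
          (show (1 : ℝ) < b by exact_mod_cast (by omega : 1 < b))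
        have h1 := Int.abs_sub_lt_one_of_floor_eq_floor (hall n)
        rw [← mul_sub, abs_mul, abs_of_nonneg (by positivity)] at h1
        rw [div_lt_iff₀ habs] at hn
        linarith
      have := Nat.sInf_mem hne
      rw [h] at this
      exact this
  · intro h
    have huv : u ≠ v := by
      rintro rfl
      exact h.2 rfl
    rw [if_neg huv, Nat.cast_inj]
    apply le_antisymm (Nat.sInf_le h)
    apply le_csInf ⟨i, h⟩
    intro j hj
    by_contra hlt
    push Not at hlt
    exact hj.2 (floor_anti b hb u v hlt h.1)

theorem vol_E (B : ℕ) (hB : 0 < B) (x y : ℝ) (hx : 0 ≤ x) (hxy : x ≤ y) :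
    (volume ((Set.Ico (0 : ℝ) x ×ˢ Set.Ico (0 : ℝ) y) ∩
      {p : ℝ × ℝ | ⌊(B : ℝ) * p.1⌋ = ⌊(B : ℝ) * p.2⌋})) =
    ENNReal.ofReal ((⌊(B : ℝ) * x⌋₊ + ((B : ℝ) * x - ⌊(B : ℝ) * x⌋₊) *
      min ((B : ℝ) * y - ⌊(B : ℝ) * x⌋₊) 1) / (B : ℝ) ^ 2) := by
  set A := ⌊(B : ℝ) * x⌋₊ with hA
  have hB' : (0 : ℝ) < B := by exact_mod_cast hB
  have hA1 : (A : ℝ) ≤ B * x := Nat.floor_le (by positivity)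
  have hA2 : (B : ℝ) * x < A + 1 := Nat.lt_floor_add_one _
  have hyx : (B : ℝ) * x ≤ B * y := by gcongr
  have hdec : ((Set.Ico (0 : ℝ) x ×ˢ Set.Ico (0 : ℝ) y) ∩
      {p : ℝ × ℝ | ⌊(B : ℝ) * p.1⌋ = ⌊(B : ℝ) * p.2⌋}) =
      (⋃ a ∈ Finset.range A, Set.Ico ((a : ℝ) / B) ((a + 1 : ℝ) / B) ×ˢ
          Set.Ico ((a : ℝ) / B) ((a + 1 : ℝ) / B)) ∪
        Set.Ico ((A : ℝ) / B) x ×ˢ Set.Ico ((A : ℝ) / B) (min y ((A + 1 : ℝ) / B)) := by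
    ext ⟨u, v⟩
    simp only [Set.mem_inter_iff, Set.mem_prod, Set.mem_Ico, Set.mem_ofPred_eq, Set.mem_union,
      Set.mem_iUnion, Finset.mem_range, lt_min_iff, div_le_iff₀ hB', lt_div_iff₀ hB', exists_prop]
    constructor
    · rintro ⟨⟨⟨hu0, hux⟩, hv0, hvy⟩, hf⟩
      have e1 : ⌊(B : ℝ) * u⌋ = (⌊(B : ℝ) * u⌋₊ : ℤ) := (Int.natCast_floor_eq_floor (by positivity)).symm
      set a := ⌊(B : ℝ) * u⌋₊ with ha
      have hfv := hf.symm.trans e1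
      rw [Int.floor_eq_iff] at e1 hfv
      push_cast at e1 hfv
      have hau : (B : ℝ) * u < B * x := by gcongr
      have haA : a ≤ A := Nat.floor_mono hau.le
      rcases haA.lt_or_eq with h | h
      · left
        refine ⟨a, h, ⟨?_, ?_⟩, ?_, ?_⟩ <;> linarith [e1.1, e1.2, hfv.1, hfv.2]
      · right
        rw [h] at e1 hfv
        refine ⟨⟨?_, ?_⟩, ?_, ?_, ?_⟩ <;> linarith [e1.1, e1.2, hfv.1, hfv.2]
    · have fl : ∀ (a : ℕ) (w : ℝ), (a : ℝ) ≤ w * B → w * B < a + 1 → ⌊(B : ℝ) * w⌋ = (a : ℤ) := by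
        intro a w h1 h2
        rw [Int.floor_eq_iff]
        push_cast
        constructor <;> linarith
      have nn : ∀ (a : ℕ) (w : ℝ), (a : ℝ) ≤ w * B → 0 ≤ w := by
        intro a w h
        have : 0 ≤ w * B := le_trans (Nat.cast_nonneg a) h
        exact nonneg_of_mul_nonneg_left this hB'
      rintro (⟨a, haA, ⟨h1, h2⟩, h3, h4⟩ | ⟨⟨h1, h2⟩, h3, h4, h5⟩)
      · have : (a : ℝ) + 1 ≤ A := by exact_mod_cast haA
        refine ⟨⟨⟨nn a u h1, ?_⟩, nn a v h3, ?_⟩, ?_⟩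
        · apply lt_of_mul_lt_mul_left _ hB'.le; linarith
        · apply lt_of_mul_lt_mul_left _ hB'.le; linarith
        · rw [fl a u h1 h2, fl a v h3 h4]
      · have hu2 : u * B < x * B := by gcongr
        refine ⟨⟨⟨nn A u h1, h2⟩, nn A v h3, h4⟩, ?_⟩
        rw [fl A u h1 (by linarith), fl A v h3 h5]
  rw [hdec, measure_union, measure_biUnion_finset]
  · simp only [Measure.volume_eq_prod, Measure.prod_prod, Real.volume_Ico]
    have hsq : ∀ a : ℕ, ENNReal.ofReal (((a : ℝ) + 1) / B - a / B) * ENNReal.ofReal (((a : ℝ) + 1) / B - a / B)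
        = ENNReal.ofReal (1 / (B : ℝ) ^ 2) := by
      intro a
      have : ((a : ℝ) + 1) / B - a / B = 1 / B := by ring
      rw [this, ← ENNReal.ofReal_mul (by positivity)]
      congr 1
      ring
    simp only [hsq, Finset.sum_const, Finset.card_range, nsmul_eq_mul]
    have hx' : (A : ℝ) / B ≤ x := by rw [div_le_iff₀ hB']; linarith
    have hm : (A : ℝ) / B ≤ min y ((A + 1 : ℝ) / B) := by
      apply le_min (by linarith)
      gcongr; linarith
    rw [← ENNReal.ofReal_natCast A, ← ENNReal.ofReal_mul (by positivity),
      ← ENNReal.ofReal_mul (by linarith), ← ENNReal.ofReal_add (by positivity)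
        (mul_nonneg (by linarith) (by linarith))]
    congr 1
    have e1 : min y ((A + 1 : ℝ) / B) - A / B = min ((B : ℝ) * y - A) 1 / B := by
      rw [← min_div_div_right hB'.le, ← min_sub_sub_right]
      congr 1
      · field_simp
      · ring
    rw [e1]
    field_simp
    
  · intro a _ c _ hac
    simp only [Function.onFun]
    rw [Set.disjoint_left]
    rintro ⟨u, v⟩ h1 h2
    simp only [Set.mem_prod, Set.mem_Ico, div_le_iff₀ hB', lt_div_iff₀ hB'] at h1 h2
    apply hac
    have h3 : (a : ℝ) < c + 1 := by linarith [h1.1.1, h2.1.2]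
    have h4 : (c : ℝ) < a + 1 := by linarith [h2.1.1, h1.1.2]
    have h3' : a < c + 1 := by exact_mod_cast h3
    have h4' : c < a + 1 := by exact_mod_cast h4
    omega
  · intro a _
    exact measurableSet_Ico.prod measurableSet_Ico
  · rw [Set.disjoint_left]
    rintro ⟨u, v⟩ h1 h2
    simp only [Set.mem_iUnion, Finset.mem_range, exists_prop] at h1
    obtain ⟨a, haA, h1⟩ := h1
    simp only [Set.mem_prod, Set.mem_Ico, div_le_iff₀ hB', lt_div_iff₀ hB'] at h1 h2
    have : (a : ℝ) + 1 ≤ A := by exact_mod_cast haA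
    linarith [h1.1.2, h2.1.1]
  · exact measurableSet_Ico.prod measurableSet_Ico

/-- The measure of the part of `[0,x) × [0,y)` where the first `n` base-`b` digits agree. -/
noncomputable def Wf (b n : ℕ) (x y : ℝ) : ℝ :=
  ((⌊(b : ℝ) ^ n * x⌋₊ : ℝ) + ((b : ℝ) ^ n * x - ⌊(b : ℝ) ^ n * x⌋₊) *
      min ((b : ℝ) ^ n * y - ⌊(b : ℝ) ^ n * x⌋₊) 1) / ((b : ℝ) ^ n) ^ 2

theorem Wf_nonneg (b n : ℕ) (x y : ℝ) (hx : 0 ≤ x) (hxy : x ≤ y) : 0 ≤ Wf b n x y := by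
  unfold Wf
  have h1 : (⌊(b : ℝ) ^ n * x⌋₊ : ℝ) ≤ (b : ℝ) ^ n * x := Nat.floor_le (by positivity)
  have h2 : (b : ℝ) ^ n * x ≤ (b : ℝ) ^ n * y := by gcongr
  have h3 : 0 ≤ min ((b : ℝ) ^ n * y - ⌊(b : ℝ) ^ n * x⌋₊) 1 := le_min (by linarith) zero_le_one
  have h4 := mul_nonneg (sub_nonneg.2 h1) h3
  positivity

theorem Wf_zero (b : ℕ) (x y : ℝ) (hx : 0 ≤ x) (hxy : x ≤ y) (hy : y ≤ 1) :
    Wf b 0 x y = x * y := by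
  unfold Wf
  simp only [pow_zero, one_mul]
  rcases (hxy.trans hy).lt_or_eq with h | h
  · rw [Nat.floor_eq_zero.2 h]
    simp [min_eq_left hy]
  · have : y = 1 := by linarith
    subst this; subst h
    simp

theorem Wf_le (b n : ℕ) (hb : 2 ≤ b) (x y : ℝ) (hx : 0 ≤ x) (hx1 : x ≤ 1) :
    Wf b n x y ≤ 1 / (b : ℝ) ^ n := by
  unfold Wf
  have hB : (0 : ℝ) < (b : ℝ) ^ n := by positivity
  have h1 : (⌊(b : ℝ) ^ n * x⌋₊ : ℝ) ≤ (b : ℝ) ^ n * x := Nat.floor_le (by positivity)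
  have h3 : min ((b : ℝ) ^ n * y - ⌊(b : ℝ) ^ n * x⌋₊) 1 ≤ 1 := min_le_right _ _
  have h4 := mul_le_mul_of_nonneg_left h3 (sub_nonneg.2 h1)
  have h5 : (b : ℝ) ^ n * x ≤ (b : ℝ) ^ n * 1 := by gcongr
  rw [div_le_div_iff₀ (by positivity) hB]
  nlinarith

theorem meas_E (B : ℝ) : MeasurableSet {p : ℝ × ℝ | ⌊B * p.1⌋ = ⌊B * p.2⌋} := by
  apply measurableSet_eq_fun
  · exact Int.measurable_floor.comp (measurable_const.mul measurable_fst)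
  · exact Int.measurable_floor.comp (measurable_const.mul measurable_snd)

theorem Vi_eq (b : ℕ) (hb : 2 ≤ b) (i : ℕ) (x y : ℝ) (hx : 0 ≤ x) (hxy : x ≤ y) (hy : y ≤ 1) :
    Vi b i x y = Wf b i x y - Wf b (i + 1) x y := by
  have hv : ∀ n, volume ((Set.Ico (0 : ℝ) x ×ˢ Set.Ico (0 : ℝ) y) ∩
      {p : ℝ × ℝ | ⌊(b : ℝ) ^ n * p.1⌋ = ⌊(b : ℝ) ^ n * p.2⌋}) = ENNReal.ofReal (Wf b n x y) := by
    intro n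
    have := vol_E (b ^ n) (by positivity) x y hx hxy
    push_cast at this
    exact this
  have hset : (Set.Ico (0 : ℝ) x ×ˢ Set.Ico (0 : ℝ) y) ∩ Dset b i =
      ((Set.Ico (0 : ℝ) x ×ˢ Set.Ico (0 : ℝ) y) ∩
        {p : ℝ × ℝ | ⌊(b : ℝ) ^ i * p.1⌋ = ⌊(b : ℝ) ^ i * p.2⌋}) \
      ((Set.Ico (0 : ℝ) x ×ˢ Set.Ico (0 : ℝ) y) ∩
        {p : ℝ × ℝ | ⌊(b : ℝ) ^ (i + 1) * p.1⌋ = ⌊(b : ℝ) ^ (i + 1) * p.2⌋}) := by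
    ext ⟨u, v⟩
    by_cases hR : (u, v) ∈ Set.Ico (0 : ℝ) x ×ˢ Set.Ico (0 : ℝ) y
    · have hu : u ∈ Set.Ico (0 : ℝ) 1 := ⟨hR.1.1, by linarith [hR.1.2]⟩
      have hv : v ∈ Set.Ico (0 : ℝ) 1 := ⟨hR.2.1, by linarith [hR.2.2]⟩
      have := gammaB_eq_iff b hb u v hu hv i
      simp only [Set.mem_inter_iff, Set.mem_sdiff, hR, true_and, Dset, Set.mem_ofPred_eq, hu, hv, this]
    · simp only [Set.mem_inter_iff, Set.mem_sdiff, hR, false_and]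
  have hsub : ((Set.Ico (0 : ℝ) x ×ˢ Set.Ico (0 : ℝ) y) ∩
        {p : ℝ × ℝ | ⌊(b : ℝ) ^ (i + 1) * p.1⌋ = ⌊(b : ℝ) ^ (i + 1) * p.2⌋}) ⊆
      ((Set.Ico (0 : ℝ) x ×ˢ Set.Ico (0 : ℝ) y) ∩
        {p : ℝ × ℝ | ⌊(b : ℝ) ^ i * p.1⌋ = ⌊(b : ℝ) ^ i * p.2⌋}) := by
    rintro ⟨u, v⟩ ⟨h1, h2⟩
    exact ⟨h1, floor_anti b hb u v (Nat.le_succ i) h2⟩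
  have hle := measure_mono (μ := volume) hsub
  unfold Vi
  rw [hset, measure_sdiff hsub
    ((measurableSet_Ico.prod measurableSet_Ico).inter (meas_E _)).nullMeasurableSet
    (by rw [hv]; exact ENNReal.ofReal_ne_top)]
  rw [hv, hv] at *
  rw [ENNReal.toReal_sub_of_le hle ENNReal.ofReal_ne_top,
    ENNReal.toReal_ofReal (Wf_nonneg _ _ _ _ hx hxy), ENNReal.toReal_ofReal (Wf_nonneg _ _ _ _ hx hxy)]

theorem gammaB_comm (b : ℕ) (x y : ℝ) : gammaB b x y = gammaB b y x := by
  unfold gammaB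
  simp only [eq_comm (a := x) (b := y), ne_eq]
  congr 3
  ext i
  simp only [Set.mem_ofPred_eq]
  rw [eq_comm, eq_comm (a := ⌊(b : ℝ) ^ (i + 1) * x⌋)]

theorem Vi_comm (b i : ℕ) (x y : ℝ) : Vi b i x y = Vi b i y x := by
  unfold Vi
  congr 1
  have hm := (Measure.measurePreserving_swap (μ := (volume : Measure ℝ)) (ν := (volume : Measure ℝ)))
  have := hm.measure_preimage_equiv (f := MeasurableEquiv.prodComm)
    ((Set.Ico (0 : ℝ) y ×ˢ Set.Ico (0 : ℝ) x) ∩ Dset b i)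
  rw [← Measure.volume_eq_prod] at this
  rw [← this]
  congr 1
  ext ⟨u, v⟩
  simp only [Dset, Set.mem_inter_iff, Set.mem_prod, Set.mem_ofPred_eq, Set.mem_preimage,
    MeasurableEquiv.prodComm, MeasurableEquiv.coe_mk, Equiv.prodComm_apply, Prod.swap]
  rw [gammaB_comm b u v]
  tauto

theorem tCoef_comm (b : ℕ) (x y : ℝ) (k : ℕ) : tCoef b x y k = tCoef b y x k := by
  cases k <;> simp only [tCoef, Vi_comm b _ x y]

theorem Vi_step (b : ℕ) (hb : 2 ≤ b) (k : ℕ) (x y : ℝ) (hx : 0 ≤ x) (hxy : x ≤ y) (hy : y ≤ 1) :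
    0 ≤ (b : ℝ) * Vi b (k + 1) x y - Vi b k x y := by
  rw [Vi_eq b hb _ x y hx hxy hy, Vi_eq b hb _ x y hx hxy hy]
  have hbR : (2 : ℝ) ≤ b := by exact_mod_cast hb
  have hb0 : (0 : ℝ) < b := by linarith
  set B : ℝ := (b : ℝ) ^ k with hBdef
  have hB : 0 < B := by positivity
  -- digit recursion
  have hrec : ∀ X : ℝ, 0 ≤ X → ∃ c : ℕ, c + 1 ≤ b ∧ ⌊(b : ℝ) * X⌋₊ = b * ⌊X⌋₊ + c := by
    intro X hX
    have h : ⌊X⌋₊ = ⌊(b : ℝ) * X⌋₊ / b := by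
      rw [← Nat.floor_div_natCast]
      congr 1
      field_simp
    refine ⟨⌊(b : ℝ) * X⌋₊ % b, Nat.mod_lt _ (by omega), ?_⟩
    rw [h, Nat.div_add_mod]
  have hX : 0 ≤ B * x := by positivity
  obtain ⟨c, hc, hc'⟩ := hrec (B * x) hX
  obtain ⟨d, hd, hd'⟩ := hrec (b * (B * x)) (by positivity)
  have e1 : (b : ℝ) ^ (k + 1) = b * B := by rw [hBdef]; ring
  have e2 : (b : ℝ) ^ (k + 1 + 1) = b * (b * B) := by rw [hBdef]; ring
  have dig : ∀ c : ℕ, c + 1 ≤ b → ((c : ℝ) ≤ b - 2 ∨ (c : ℝ) = b - 1) := by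
    intro c hc
    rcases hc.lt_or_eq with h | h
    · left
      have : ((c + 2 : ℕ) : ℝ) ≤ b := by exact_mod_cast h
      push_cast at this; linarith
    · right
      rw [← h]; push_cast; ring
  have dig0 : ((d : ℝ) = 0 ∨ (1 : ℝ) ≤ d) := by
    rcases Nat.eq_zero_or_pos d with h | h
    · left; exact_mod_cast h
    · right; exact_mod_cast h
  unfold Wf
  rw [e1, e2]
  simp only [mul_assoc]
  rw [hd', hc', ← hBdef]
  have f0 := Nat.floor_le hX
  have f1 : ((⌊(b : ℝ) * (B * x)⌋₊ : ℕ) : ℝ) ≤ b * (B * x) := Nat.floor_le (by positivity)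
  have f2 : ((⌊(b : ℝ) * (b * (B * x))⌋₊ : ℕ) : ℝ) ≤ b * (b * (B * x)) := Nat.floor_le (by positivity)
  have g1 := Nat.lt_floor_add_one ((b : ℝ) * (B * x))
  have g2 := Nat.lt_floor_add_one ((b : ℝ) * (b * (B * x)))
  rw [hd', hc'] at f2 g2
  rw [hc'] at f1 g1
  push_cast at f1 f2 g1 g2 ⊢
  set A : ℝ := (⌊B * x⌋₊ : ℝ) with hA
  have hxyB : B * x ≤ B * y := by gcongr
  have hcb : (c : ℝ) + 1 ≤ b := by exact_mod_cast hc
  have hdb : (d : ℝ) + 1 ≤ b := by exact_mod_cast hd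
  have q1 : min ((b : ℝ) * (B * y) - (b * A + c)) 1 = min (b * min (B * y - A) 1 - c) 1 := by
    rcases le_total (B * y - A) 1 with h | h
    · rw [min_eq_left h]; congr 1; ring
    · have hh := mul_le_mul_of_nonneg_left h hb0.le
      rw [min_eq_right h, min_eq_right (by linarith), min_eq_right (by linarith)]
  have q2 : min ((b : ℝ) * (b * (B * y)) - (b * (b * A + c) + d)) 1
      = min (b * min ((b : ℝ) * (B * y) - (b * A + c)) 1 - d) 1 := by
    rcases le_total ((b : ℝ) * (B * y) - (b * A + c)) 1 with h | h
    · rw [min_eq_left h]; congr 1; ring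
    · have hh := mul_le_mul_of_nonneg_left h hb0.le
      rw [min_eq_right h, min_eq_right (by linarith), min_eq_right (by linarith)]
  have hp1 : B * x < A + 1 := Nat.lt_floor_add_one _
  have S := step_ineq b A c d (B * x - A) (min (B * y - A) 1) hbR (Nat.cast_nonneg c) (dig c hc)
    (dig d hd) dig0 (le_min (by linarith) (by linarith)) (min_le_right _ _)
    (b * (B * x) - (b * A + c)) (min ((b : ℝ) * (B * y) - (b * A + c)) 1)
    (b * (b * (B * x)) - (b * (b * A + c) + d)) (min ((b : ℝ) * (b * (B * y)) - (b * (b * A + c) + d)) 1)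
    (by ring) (by ring) (by linarith) (by linarith) (by linarith) (by linarith) (by linarith) q1 q2
  generalize min ((b : ℝ) * (B * y) - (b * A + c)) 1 = Q1 at *
  generalize min ((b : ℝ) * (b * (B * y)) - (b * (b * A + c) + d)) 1 = Q2 at *
  generalize min (B * y - A) 1 = Q0 at *
  have := div_nonneg S (sq_nonneg B)
  refine this.trans_eq ?_
  field_simp

theorem tCoef_nonneg (b : ℕ) (hb : 2 ≤ b) (x y : ℝ) (hx : x ∈ Set.Icc (0 : ℝ) 1)
    (hy : y ∈ Set.Icc (0 : ℝ) 1) (k : ℕ) : 0 ≤ tCoef b x y k := by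
  wlog hxy : x ≤ y generalizing x y
  · rw [tCoef_comm]
    exact this y x hy hx (le_of_not_ge hxy)
  have hbR : (2 : ℝ) ≤ b := by exact_mod_cast hb
  cases k with
  | zero =>
    unfold tCoef
    have : 0 ≤ Vi b 0 x y := ENNReal.toReal_nonneg
    exact div_nonneg (by positivity) (by linarith)
  | succ k =>
    unfold tCoef
    exact div_nonneg (Vi_step b hb k x y hx.1 hxy hy.2) (by linarith)

theorem hasSum_Vi (b : ℕ) (hb : 2 ≤ b) (x y : ℝ) (hx : 0 ≤ x) (hxy : x ≤ y) (hy : y ≤ 1) :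
    HasSum (fun k => Vi b k x y) (x * y) := by
  have hbR : (2 : ℝ) ≤ b := by exact_mod_cast hb
  rw [hasSum_iff_tendsto_nat_of_nonneg (fun k => show 0 ≤ Vi b k x y from ENNReal.toReal_nonneg)]
  have h : ∀ n, ∑ k ∈ Finset.range n, Vi b k x y = x * y - Wf b n x y := by
    intro n
    simp only [Vi_eq b hb _ x y hx hxy hy]
    rw [Finset.sum_range_sub', Wf_zero b x y hx hxy hy]
  simp only [h]
  have h0 : Filter.Tendsto (fun n => Wf b n x y) Filter.atTop (nhds 0) := by
    apply squeeze_zero (fun n => Wf_nonneg b n x y hx hxy)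
      (fun n => Wf_le b n hb x y hx (hxy.trans hy))
    have := tendsto_pow_atTop_nhds_zero_of_lt_one (r := 1 / (b : ℝ)) (by positivity)
      (by rw [div_lt_one (by linarith)]; linarith)
    simpa using this
  simpa using h0.const_sub (x * y)

theorem hasSum_tCoef (b : ℕ) (hb : 2 ≤ b) (x y : ℝ) (hx : x ∈ Set.Icc (0 : ℝ) 1)
    (hy : y ∈ Set.Icc (0 : ℝ) 1) : HasSum (tCoef b x y) (x * y) := by
  wlog hxy : x ≤ y generalizing x y
  · have h := this y x hy hx (le_of_not_ge hxy)
    rw [mul_comm]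
    convert h using 1
    funext k
    exact tCoef_comm b x y k
  have hbR : (2 : ℝ) ≤ b := by exact_mod_cast hb
  have hV := hasSum_Vi b hb x y hx.1 hxy hy.2
  rw [← hasSum_nat_add_iff' 1]
  have h1 := (hasSum_nat_add_iff' 1).2 hV
  have h2 := ((h1.mul_left (b : ℝ)).sub hV).div_const ((b : ℝ) - 1)
  have hb1 : (b : ℝ) - 1 ≠ 0 := by linarith
  have e : x * y - ∑ i ∈ Finset.range 1, tCoef b x y i =
      ((b : ℝ) * (x * y - ∑ i ∈ Finset.range 1, Vi b i x y) - x * y) / ((b : ℝ) - 1) := by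
    simp only [Finset.sum_range_one, tCoef]
    field_simp
    ring
  rw [e]
  exact h2

theorem hasSum_pi_prod (s : ℕ) (f : Fin s → ℕ → ℝ) (a : Fin s → ℝ) (hf : ∀ j k, 0 ≤ f j k)
    (h : ∀ j, HasSum (f j) (a j)) :
    HasSum (fun k : Fin s → ℕ => ∏ j, f j (k j)) (∏ j, a j) := by
  induction s with
  | zero =>
    simp only [Finset.univ_eq_empty, Finset.prod_empty]
    have := hasSum_unique (fun _ : Fin 0 → ℕ => (1 : ℝ))
    exact this
  | succ s ih =>
    have ih' := ih (fun j => f j.succ) (fun j => a j.succ) (fun j k => hf _ _) (fun j => h _)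
    have hs := (h 0).summable.mul_of_nonneg ih'.summable (fun k => hf 0 k)
      (fun k => Finset.prod_nonneg fun j _ => hf _ _)
    have hm := (h 0).mul ih' hs
    rw [Fin.prod_univ_succ]
    rw [← (Fin.consEquiv (fun _ : Fin (s + 1) => ℕ)).hasSum_iff]
    have e : ((fun k : Fin (s + 1) → ℕ => ∏ j, f j (k j)) ∘ (Fin.consEquiv (fun _ : Fin (s + 1) => ℕ)))
        = fun p : ℕ × (Fin s → ℕ) => f 0 p.1 * ∏ j, f j.succ (p.2 j) := by
      funext p
      simp [Fin.prod_univ_succ, Fin.consEquiv]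
    rw [e]
    exact hm

theorem Vi_expand (b : ℕ) (hb : 2 ≤ b) (x y : ℝ) (i : ℕ) :
    Vi b i x y = ∑ k : Fin (i + 1), tCoef b x y k * (((b : ℝ) - 1) / (b : ℝ) ^ (1 + (i - k))) := by
  have hbR : (2 : ℝ) ≤ b := by exact_mod_cast hb
  have h1 : (b : ℝ) - 1 ≠ 0 := by linarith
  have hb0 : (b : ℝ) ≠ 0 := by linarith
  rw [Fin.sum_univ_eq_sum_range (fun k => tCoef b x y k * (((b : ℝ) - 1) / (b : ℝ) ^ (1 + (i - k))))]
  induction i with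
  | zero =>
    simp [tCoef]
    field_simp
  | succ i ih =>
    rw [Finset.sum_range_succ]
    have : ∑ k ∈ Finset.range (i + 1), tCoef b x y k * (((b : ℝ) - 1) / (b : ℝ) ^ (1 + (i + 1 - k)))
        = Vi b i x y / b := by
      rw [ih, Finset.sum_div]
      apply Finset.sum_congr rfl
      intro k hk
      have hk' : k ≤ i := by simpa [Nat.lt_succ_iff] using hk
      rw [show 1 + (i + 1 - k) = (1 + (i - k)) + 1 by omega, pow_succ]
      field_simp
    rw [this]
    simp [tCoef]
    field_simp
    ring

theorem ViS_eq_prod (b s : ℕ) (i : Fin s → ℕ) (x y : Fin s → ℝ) :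
    ViS b s i x y = ∏ j, Vi b (i j) (x j) (y j) := by
  unfold ViS Vi
  rw [← ENNReal.toReal_prod, ← volume_pi_pi]
  congr 1
  have hm := (volume_measurePreserving_arrowProdEquivProdArrow ℝ ℝ (Fin s))
  rw [← hm.measure_preimage_equiv]
  congr 1
  ext p
  simp only [Rset, DsetS, Dset, Set.mem_inter_iff, Set.mem_prod, Set.mem_ofPred_eq, Set.mem_preimage,
    Set.mem_pi, Set.mem_univ, true_imp_iff, MeasurableEquiv.arrowProdEquivProdArrow,
    MeasurableEquiv.coe_mk, Equiv.arrowProdEquivProdArrow, Equiv.coe_fn_mk, forall_and]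

theorem stmt14 (b s : ℕ) (hb : 2 ≤ b) (hs : 1 ≤ s) (x y : Fin s → ℝ)
    (hx : ∀ j, x j ∈ Set.Icc (0 : ℝ) 1) (hy : ∀ j, y j ∈ Set.Icc (0 : ℝ) 1) :
    (∀ k : Fin s → ℕ, 0 ≤ ∏ j, tCoef b (x j) (y j) (k j)) ∧
    (∀ i : Fin s → ℕ,
      ViS b s i x y = ∑ k : ((j : Fin s) → Fin (i j + 1)),
        (∏ j, tCoef b (x j) (y j) ((k j : ℕ))) * ((b : ℝ) - 1) ^ s /
          (b : ℝ) ^ (s + ∑ j, (i j - (k j : ℕ)))) ∧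
    HasSum (fun k : Fin s → ℕ => ∏ j, tCoef b (x j) (y j) (k j)) (∏ j, x j * y j) := by
  refine ⟨fun k => Finset.prod_nonneg fun j _ => tCoef_nonneg b hb _ _ (hx j) (hy j) _, ?_,
    hasSum_pi_prod s _ _ (fun j k => tCoef_nonneg b hb _ _ (hx j) (hy j) k)
      (fun j => hasSum_tCoef b hb _ _ (hx j) (hy j))⟩
  intro i
  rw [ViS_eq_prod]
  simp only [Vi_expand b hb]
  rw [Finset.prod_univ_sum, Fintype.piFinset_univ]
  apply Finset.sum_congr rfl
  intro k _
  rw [Finset.prod_mul_distrib, Finset.prod_div_distrib, Finset.prod_pow_eq_pow_sum,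
    Finset.sum_add_distrib]
  simp [mul_div_assoc]
end

section
/- Let b ≥ 2, s ≥ 1, n ≥ 2, and let P_n = (V_1,…,V_n) be points in [0,1)^s such that for each j the j-th coordinates V_{1,j},…,V_{n,j} are pairwise distinct, with associated function ψ. Then the following are equivalent: (1) for all x, y ∈ [0,1]^s, the Lebesgue integral of ψ over R(x,y) is at most ∏_{j=1}^s x_j·y_j; (2) P_n is completely quasi-equidistributed in base b, i.e., C_b(k;P_n) ≤ 1 for every k ∈ ℕ^s. (Condition (1) is precisely the statement that any base-b digitally scrambled version of P_n is negatively lower orthant dependent.) -/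
open MeasureTheory
open scoped Classical

noncomputable def mB {n s : ℕ} (b : ℕ) (P : Fin n → Fin s → ℝ) (k : Fin s → ℕ) (l : Fin n) : ℕ :=
  (Finset.univ.filter fun j : Fin n =>
    j ≠ l ∧ ∀ r : Fin s, (k r : ℕ∞) ≤ gammaB b (P l r) (P j r)).card

noncomputable def nB {n s : ℕ} (b : ℕ) (P : Fin n → Fin s → ℝ) (i : Fin s → ℕ) (l : Fin n) : ℕ :=
  (Finset.univ.filter fun j : Fin n =>
    j ≠ l ∧ ∀ r : Fin s, gammaB b (P l r) (P j r) = (i r : ℕ∞)).card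

noncomputable def MB {n s : ℕ} (b : ℕ) (P : Fin n → Fin s → ℝ) (k : Fin s → ℕ) : ℕ :=
  ∑ l : Fin n, mB b P k l

noncomputable def NB {n s : ℕ} (b : ℕ) (P : Fin n → Fin s → ℝ) (i : Fin s → ℕ) : ℕ :=
  ∑ l : Fin n, nB b P i l

noncomputable def CB {n s : ℕ} (b : ℕ) (P : Fin n → Fin s → ℝ) (k : Fin s → ℕ) : ℝ :=
  (b : ℝ) ^ (∑ j, k j) * (MB b P k : ℝ) / ((n : ℝ) * ((n : ℝ) - 1))

noncomputable def psi {n s : ℕ} (b : ℕ) (P : Fin n → Fin s → ℝ) (x y : Fin s → ℝ) : ℝ :=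
  if ∀ j, gammaB b (x j) (y j) ≠ ⊤ then
    (NB b P (fun j => (gammaB b (x j) (y j)).toNat) : ℝ) *
      (b : ℝ) ^ (s + ∑ j, (gammaB b (x j) (y j)).toNat) /
      (((b : ℝ) - 1) ^ s * ((n : ℝ) * ((n : ℝ) - 1)))
  else 0


noncomputable def G (a a' : ℝ) : ℝ :=
  if ⌊a⌋ = ⌊a'⌋ then (⌊a⌋ : ℝ) + Int.fract a * Int.fract a' else min a a'

noncomputable def cl (z : ℝ) : ℝ := max (min z 1) 0

lemma G_symm (a a' : ℝ) : G a a' = G a' a := by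
  unfold G
  by_cases h : ⌊a⌋ = ⌊a'⌋
  · rw [if_pos h, if_pos h.symm, h, mul_comm]
  · rw [if_neg h, if_neg (fun h' => h h'.symm), min_comm]

lemma G_same {f : ℤ} {t t' : ℝ} (h0 : 0 ≤ t) (h1 : t < 1) (h0' : 0 ≤ t') (h1' : t' < 1) :
    G (f + t) (f + t') = f + t * t' := by
  have e : ⌊(f : ℝ) + t⌋ = f := by
    rw [Int.floor_eq_iff]; constructor <;> linarith
  have e' : ⌊(f : ℝ) + t'⌋ = f := by
    rw [Int.floor_eq_iff]; constructor <;> linarith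
  unfold G
  rw [if_pos (by rw [e, e']), Int.fract, Int.fract, e, e']
  ring

lemma G_diff {a a' : ℝ} (h : ⌊a⌋ < ⌊a'⌋) : G a a' = a := by
  unfold G
  rw [if_neg h.ne, min_eq_left]
  by_contra hh
  push Not at hh
  exact absurd (Int.floor_le_floor hh.le) (by omega)

lemma floor_cases (a a' : ℝ) (h : ⌊a⌋ = ⌊a'⌋) : ∃ (f : ℤ) (t t' : ℝ), 0 ≤ t ∧ t < 1 ∧ 0 ≤ t' ∧ t' < 1
    ∧ a = f + t ∧ a' = f + t' := by
  refine ⟨⌊a⌋, Int.fract a, Int.fract a', Int.fract_nonneg _, Int.fract_lt_one _,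
    Int.fract_nonneg _, Int.fract_lt_one _, (Int.floor_add_fract a).symm, ?_⟩
  rw [h]; exact (Int.floor_add_fract a').symm

lemma G_le_left (a a' : ℝ) : G a a' ≤ a := by
  by_cases h : ⌊a⌋ = ⌊a'⌋
  · obtain ⟨f, t, t', h0, h1, h0', h1', rfl, rfl⟩ := floor_cases a a' h
    rw [G_same h0 h1 h0' h1']
    nlinarith
  · unfold G; rw [if_neg h]; exact min_le_left _ _

lemma G_shift (m : ℤ) (a a' : ℝ) : G (m + a) (m + a') = m + G a a' := by
  unfold G
  simp only [Int.floor_intCast_add, Int.fract_intCast_add, add_right_inj]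
  split_ifs
  · push_cast; ring
  · rw [min_add_add_left]

lemma G_le_mul {p q : ℝ} (hp : 0 ≤ p) (hq : 0 ≤ q) : G p q ≤ p * q := by
  wlog h : ⌊p⌋ ≤ ⌊q⌋ generalizing p q
  · rw [G_symm, mul_comm]; exact this hq hp (by omega)
  rcases h.lt_or_eq with h | h
  · rw [G_diff h]
    have : (1 : ℤ) ≤ ⌊q⌋ := by have := Int.floor_nonneg.2 hp; omega
    have : (1 : ℝ) ≤ q := by simpa using Int.le_floor.1 this
    nlinarith
  · have hf := Int.floor_nonneg.2 hp
    obtain ⟨f, t, t', h0, h1, h0', h1', rfl, rfl⟩ := floor_cases p q h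
    rw [G_same h0 h1 h0' h1']
    have e : ⌊(f : ℝ) + t⌋ = f := by
      rw [Int.floor_eq_iff]; constructor <;> linarith
    rw [e] at hf
    have hf' : (0 : ℝ) ≤ f := by exact_mod_cast hf
    have : (f : ℝ) ≤ f * f := by exact_mod_cast (by nlinarith [mul_self_nonneg f, Int.le_self_sq f] : f ≤ f * f)
    nlinarith [mul_nonneg hf' h0, mul_nonneg hf' h0']

lemma G_le_upper {b : ℕ} {p q : ℝ} (hp : p < b) (hq : q < b) :
    G p q ≤ p * q - (b - 1) * (p + q - b) := by
  wlog h : ⌊p⌋ ≤ ⌊q⌋ generalizing p q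
  · rw [G_symm, mul_comm, add_comm]; exact this hq hp (by omega)
  have hqb : ⌊q⌋ < b := by rw [Int.floor_lt]; exact_mod_cast hq
  rcases h.lt_or_eq with h | h
  · rw [G_diff h]
    have : ⌊p⌋ < (b : ℤ) - 1 := by omega
    rw [Int.floor_lt] at this
    push_cast at this
    nlinarith
  · obtain ⟨f, t, t', h0, h1, h0', h1', rfl, rfl⟩ := floor_cases p q h
    rw [G_same h0 h1 h0' h1']
    have e : ⌊(f : ℝ) + t'⌋ = f := by
      rw [Int.floor_eq_iff]; constructor <;> linarith
    rw [e] at hqb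
    obtain ⟨g, hg⟩ : ∃ g : ℕ, (b : ℤ) = f + 1 + g := ⟨(b - 1 - f).toNat, by omega⟩
    have hg' : (b : ℝ) = f + 1 + g := by exact_mod_cast hg
    rw [hg']
    have : 0 ≤ (g : ℝ) * (g + 1 - t - t') := by
      rcases Nat.eq_zero_or_pos g with rfl | h
      · simp
      · have : (1 : ℝ) ≤ g := by exact_mod_cast h
        apply mul_nonneg <;> linarith
    nlinarith

lemma floor_div_nat {b : ℕ} (hb : 2 ≤ b) (a : ℝ) : ∃ d : ℕ, d < b ∧ ⌊(b : ℝ) * a⌋ = b * ⌊a⌋ + d := by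
  have hb0 : (0 : ℝ) < b := by positivity
  have h1 : (b : ℤ) * ⌊a⌋ ≤ ⌊(b : ℝ) * a⌋ := by
    rw [Int.le_floor]; push_cast; exact mul_le_mul_of_nonneg_left (Int.floor_le a) hb0.le
  have h2 : ⌊(b : ℝ) * a⌋ < (b : ℤ) * ⌊a⌋ + b := by
    rw [Int.floor_lt]; push_cast; nlinarith [Int.lt_floor_add_one a]
  exact ⟨(⌊(b : ℝ) * a⌋ - b * ⌊a⌋).toNat, by omega, by omega⟩

lemma floor_mono {b : ℕ} (hb : 2 ≤ b) {a a' : ℝ} (h : ⌊(b : ℝ) * a⌋ = ⌊(b : ℝ) * a'⌋) : ⌊a⌋ = ⌊a'⌋ := by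
  obtain ⟨d, hd, e⟩ := floor_div_nat hb a
  obtain ⟨d', hd', e'⟩ := floor_div_nat hb a'
  rw [e, e'] at h
  rcases lt_trichotomy ⌊a⌋ ⌊a'⌋ with h3 | h3 | h3
  · nlinarith
  · exact h3
  · nlinarith

lemma digits {b : ℕ} (hb : 2 ≤ b) {a a' : ℝ} (h : ⌊(b : ℝ) * a⌋ = ⌊(b : ℝ) * a'⌋) :
    ∃ (m : ℤ) (d : ℕ) (t t' : ℝ), d < b ∧ 0 ≤ t ∧ t < 1 ∧ 0 ≤ t' ∧ t' < 1 ∧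
      a = m + (d + t) / b ∧ a' = m + (d + t') / b ∧ G (b * a) (b * a') = b * m + d + t * t' ∧
      G a a' = m + (d + t) * (d + t') / b ^ 2 ∧
      G (b * (b * a)) (b * (b * a')) = b * (b * m + d) + G (b * t) (b * t') := by
  have hb0 : (0 : ℝ) < b := by positivity
  obtain ⟨d, hd, e⟩ := floor_div_nat hb a
  obtain ⟨f, t, t', h0, h1, h0', h1', hf, hf'⟩ := floor_cases _ _ h
  have ef : ⌊(b : ℝ) * a⌋ = f := by
    rw [hf, Int.floor_eq_iff]; constructor <;> linarith
  have hfe : (f : ℝ) = b * ⌊a⌋ + d := by rw [ef] at e; exact_mod_cast e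
  have hd' : (d : ℝ) + 1 ≤ b := by exact_mod_cast hd
  have ha : a = (⌊a⌋ : ℝ) + (d + t) / b := by field_simp; linarith
  have ha' : a' = (⌊a⌋ : ℝ) + (d + t') / b := by field_simp; linarith
  refine ⟨⌊a⌋, d, t, t', hd, h0, h1, h0', h1', ha, ha', ?_, ?_, ?_⟩
  · rw [hf, hf', G_same h0 h1 h0' h1', hfe]
  · have := G_same (f := ⌊a⌋) (t := (d + t) / b) (t' := (d + t') / b) (by positivity)
      (by rw [div_lt_one hb0]; linarith) (by positivity) (by rw [div_lt_one hb0]; linarith)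
    rw [← ha, ← ha'] at this
    rw [this]; field_simp
  · rw [hf, hf']
    have := G_shift (b * f) (b * t) (b * t')
    push_cast at this
    rw [mul_add, mul_add, this, hfe]

lemma G_grow {b : ℕ} (hb : 2 ≤ b) (a a' : ℝ) : b * G a a' ≤ G (b * a) (b * a') := by
  have hb0 : (0 : ℝ) < b := by positivity
  wlog h : ⌊(b : ℝ) * a⌋ ≤ ⌊(b : ℝ) * a'⌋ generalizing a a'
  · rw [G_symm, G_symm (b * a)]; exact this a' a (by omega)
  rcases h.lt_or_eq with h | h
  · rw [G_diff h]; exact mul_le_mul_of_nonneg_left (G_le_left _ _) hb0.le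
  · obtain ⟨m, d, t, t', hd, h0, h1, h0', h1', -, -, e1, e2, -⟩ := digits hb h
    rw [e1, e2]
    have : (b : ℝ) * (m + (d + t) * (d + t') / b ^ 2) = b * m + (d + t) * (d + t') / b := by
      field_simp
    rw [this, add_assoc]
    gcongr
    rw [div_le_iff₀ hb0]
    have hd0 : (0 : ℝ) ≤ d := by positivity
    obtain h2 | h2 : d + 1 = b ∨ d + 2 ≤ b := by omega
    · have : (b : ℝ) = d + 1 := by exact_mod_cast h2.symm
      rw [this]
      nlinarith [mul_nonneg hd0 (mul_nonneg (sub_nonneg.2 h1.le) (sub_nonneg.2 h1'.le))]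
    · have : (d : ℝ) + 2 ≤ b := by exact_mod_cast h2
      nlinarith [mul_nonneg hd0 (by linarith : (0 : ℝ) ≤ b - d - t - t'), mul_nonneg h0 h0']

lemma G_convex {b : ℕ} (hb : 2 ≤ b) (a a' : ℝ) :
    b ^ 3 * G a a' + G (b * (b * a)) (b * (b * a')) ≤ b * (b + 1) * G (b * a) (b * a') := by
  have hb0 : (0 : ℝ) < b := by positivity
  wlog h : ⌊(b : ℝ) * a⌋ ≤ ⌊(b : ℝ) * a'⌋ generalizing a a'
  · rw [G_symm, G_symm (b * a), G_symm (b * (b * a))]; exact this a' a (by omega)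
  rcases h.lt_or_eq with h | h
  · rw [G_diff h]
    have h1 := mul_le_mul_of_nonneg_left (G_le_left a a') (by positivity : (0 : ℝ) ≤ b ^ 3)
    have h2 := G_le_left (b * (b * a)) (b * (b * a'))
    nlinarith
  · obtain ⟨m, d, t, t', hd, h0, h1, h0', h1', -, -, e1, e2, e3⟩ := digits hb h
    rw [e1, e2, e3]
    have : (b : ℝ) ^ 3 * (m + (d + t) * (d + t') / b ^ 2) = b ^ 3 * m + b * ((d + t) * (d + t')) := by
      field_simp
    rw [this]
    have hd0 : (0 : ℝ) ≤ d := by positivity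
    obtain h2 | h2 : d + 1 = b ∨ d + 2 ≤ b := by omega
    · have hG := G_le_upper (b := b) (p := b * t) (q := b * t') (by nlinarith) (by nlinarith)
      have : (b : ℝ) = d + 1 := by exact_mod_cast h2.symm
      have : (d : ℝ) = b - 1 := by linarith
      rw [this]
      nlinarith
    · have : (d : ℝ) + 2 ≤ b := by exact_mod_cast h2
      have hG := G_le_mul (p := b * t) (q := b * t') (by positivity) (by positivity)
      have := mul_nonneg (mul_nonneg hb0.le hd0) (by linarith : (0 : ℝ) ≤ b - d - t - t')
      nlinarith

lemma cl_of_nonpos {z : ℝ} (h : z ≤ 0) : cl z = 0 := by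
  unfold cl; rw [max_eq_right]; exact (min_le_left _ _).trans h
lemma cl_of_ge {z : ℝ} (h : 1 ≤ z) : cl z = 1 := by
  unfold cl; rw [min_eq_right h]; simp
lemma cl_of_mid {z : ℝ} (h : 0 ≤ z) (h' : z ≤ 1) : cl z = z := by
  unfold cl; rw [min_eq_left h', max_eq_left h]

lemma sum_cl_aux {N : ℕ} {a a' : ℝ} (h : 0 ≤ a) (h' : 0 ≤ a') (h1 : a < 1) :
    ∑ c ∈ Finset.range (N + 1), cl (a - c) * cl (a' - c) = G a a' := by
  rw [Finset.sum_range_succ', Finset.sum_eq_zero]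
  · simp only [Nat.cast_zero, sub_zero, zero_add]
    rw [cl_of_mid h h1.le]
    have e : ⌊a⌋ = 0 := by rw [Int.floor_eq_iff]; simp [h, h1]
    rcases lt_or_ge a' 1 with h2 | h2
    · rw [cl_of_mid h' h2.le]
      have := G_same (f := 0) h h1 h' h2
      simpa using this.symm
    · rw [cl_of_ge h2, G_diff, mul_one]
      rw [e]; exact Int.lt_iff_add_one_le.2 (Int.le_floor.2 (by simpa using h2))
  · intro c _
    rw [cl_of_nonpos, zero_mul]
    push_cast
    have : (0 : ℝ) ≤ c := by positivity
    linarith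

lemma sum_cl (N : ℕ) : ∀ {a a' : ℝ}, 0 ≤ a → 0 ≤ a' → a < N → a' < N →
    ∑ c ∈ Finset.range N, cl (a - c) * cl (a' - c) = G a a' := by
  induction N with
  | zero => intro a a' h _ h1; simp at h1; linarith
  | succ N ih =>
    intro a a' h h' hN hN'
    rcases lt_or_ge a 1 with h1 | h1
    · exact sum_cl_aux h h' h1
    rcases lt_or_ge a' 1 with h2 | h2
    · rw [G_symm, ← sum_cl_aux (N := N) h' h h2]
      exact Finset.sum_congr rfl fun c _ => mul_comm _ _
    push_cast at hN hN'
    have := ih (a := a - 1) (a' := a' - 1) (by linarith) (by linarith) (by linarith) (by linarith)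
    rw [Finset.sum_range_succ']
    have e := G_shift 1 (a - 1) (a' - 1)
    simp only [Int.cast_one, add_sub_cancel] at e
    rw [e, ← this]
    simp only [Nat.cast_zero, sub_zero]
    rw [cl_of_ge h1, cl_of_ge h2, add_comm, mul_one]
    congr 1
    apply Finset.sum_congr rfl
    intro c _
    push_cast
    congr 2 <;> ring

noncomputable def WB (b k : ℕ) (x y : ℝ) : ℝ :=
  G ((b : ℝ) ^ k * x) ((b : ℝ) ^ k * y) / ((b : ℝ) ^ k) ^ 2

noncomputable def fB (b k : ℕ) (x y : ℝ) : ℝ :=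
  (b : ℝ) ^ (k + 1) / ((b : ℝ) - 1) * (WB b k x y - WB b (k + 1) x y)

lemma floor_mono_pow {b : ℕ} (hb : 2 ≤ b) {u v : ℝ} {i j : ℕ} (hij : i ≤ j)
    (h : ⌊(b : ℝ) ^ j * u⌋ = ⌊(b : ℝ) ^ j * v⌋) : ⌊(b : ℝ) ^ i * u⌋ = ⌊(b : ℝ) ^ i * v⌋ := by
  induction j, hij using Nat.le_induction with
  | base => exact h
  | succ j _ ih =>
    apply ih
    rw [pow_succ', mul_assoc, mul_assoc] at h
    exact floor_mono hb h

lemma exists_floor_ne {b : ℕ} (hb : 2 ≤ b) {u v : ℝ} (h : u ≠ v) :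
    ∃ k : ℕ, ⌊(b : ℝ) ^ k * u⌋ ≠ ⌊(b : ℝ) ^ k * v⌋ := by
  have hb1 : (1 : ℝ) < b := by exact_mod_cast hb
  have h0 : 0 < |u - v| := abs_pos.2 (sub_ne_zero.2 h)
  obtain ⟨k, hk⟩ := pow_unbounded_of_one_lt (1 / |u - v|) hb1
  refine ⟨k, fun he => ?_⟩
  have := Int.abs_sub_lt_one_of_floor_eq_floor he
  rw [← mul_sub, abs_mul, abs_of_pos (by positivity)] at this
  rw [div_lt_iff₀ h0] at hk
  linarith

lemma gamma_iff {b : ℕ} (hb : 2 ≤ b) {u v : ℝ} (hu : u ∈ Set.Ico (0 : ℝ) 1) (hv : v ∈ Set.Ico (0 : ℝ) 1)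
    (i : ℕ) : gammaB b u v = (i : ℕ∞) ↔ ⌊(b : ℝ) ^ i * u⌋ = ⌊(b : ℝ) ^ i * v⌋ ∧
      ⌊(b : ℝ) ^ (i + 1) * u⌋ ≠ ⌊(b : ℝ) ^ (i + 1) * v⌋ := by
  unfold gammaB
  split_ifs with h
  · subst h; simp
  set S := {i : ℕ | ⌊(b : ℝ) ^ i * u⌋ = ⌊(b : ℝ) ^ i * v⌋ ∧
      ⌊(b : ℝ) ^ (i + 1) * u⌋ ≠ ⌊(b : ℝ) ^ (i + 1) * v⌋} with hS
  have hne : S.Nonempty := by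
    have hex := exists_floor_ne hb h
    have h1 := Nat.find_spec hex
    have h2 : Nat.find hex ≠ 0 := by
      intro h0
      rw [h0] at h1
      apply h1
      simp only [pow_zero, one_mul]
      rw [Int.floor_eq_zero_iff.2 hu, Int.floor_eq_zero_iff.2 hv]
    obtain ⟨m, hm⟩ := Nat.exists_eq_succ_of_ne_zero h2
    refine ⟨m, ?_, ?_⟩
    · by_contra hc
      exact Nat.find_min hex (m := m) (by omega) hc
    · rw [hm] at h1; exact h1
  have hmem := Nat.sInf_mem hne
  rw [Nat.cast_inj]
  constructor
  · rintro rfl; exact hmem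
  · intro hi
    apply le_antisymm (Nat.sInf_le hi)
    by_contra hc
    push Not at hc
    exact hmem.2 (floor_mono_pow hb (by omega) hi.1)

def SB (b k : ℕ) (x y : ℝ) : Set (ℝ × ℝ) :=
  {p | p.1 ∈ Set.Ico 0 x ∧ p.2 ∈ Set.Ico 0 y ∧ ⌊(b : ℝ) ^ k * p.1⌋ = ⌊(b : ℝ) ^ k * p.2⌋}

lemma SB_meas (b k : ℕ) (x y : ℝ) : MeasurableSet (SB b k x y) := by
  unfold SB
  have h1 : Measurable fun p : ℝ × ℝ => ⌊(b : ℝ) ^ k * p.1⌋ := by fun_prop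
  have h2 : Measurable fun p : ℝ × ℝ => ⌊(b : ℝ) ^ k * p.2⌋ := by fun_prop
  exact (measurable_fst measurableSet_Ico).inter
    ((measurable_snd measurableSet_Ico).inter (measurableSet_eq_fun h1 h2))

lemma SB_fin (b k : ℕ) (x y : ℝ) : volume (SB b k x y) ≠ ⊤ := by
  have : SB b k x y ⊆ Set.Ico 0 x ×ˢ Set.Ico 0 y := fun p hp => ⟨hp.1, hp.2.1⟩
  refine ne_top_of_le_ne_top ?_ (measure_mono this)
  rw [Measure.volume_eq_prod, Measure.prod_prod]
  exact ENNReal.mul_ne_top (by simp) (by simp)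

lemma J_vol {B : ℝ} (hB : 0 < B) (c : ℕ) (x : ℝ) :
    volume.real (Set.Ico ((c : ℝ) / B) (min x ((c + 1) / B))) = cl (B * x - c) / B := by
  rw [Real.volume_real_Ico]
  unfold cl
  rw [eq_div_iff hB.ne', max_mul_of_nonneg _ _ hB.le, zero_mul, sub_mul, min_mul_of_nonneg _ _ hB.le,
    div_mul_cancel₀ _ hB.ne', div_mul_cancel₀ _ hB.ne', ← min_sub_sub_right, mul_comm x,
    add_sub_cancel_left]

lemma J_mem {B : ℝ} (hB : 0 < B) (c : ℕ) (x u : ℝ) :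
    u ∈ Set.Ico ((c : ℝ) / B) (min x ((c + 1) / B)) ↔ u ∈ Set.Ico 0 x ∧ ⌊B * u⌋ = (c : ℤ) := by
  rw [Int.floor_eq_iff, Set.mem_Ico, Set.mem_Ico, lt_min_iff, div_le_iff₀ hB, lt_div_iff₀ hB, mul_comm B]
  push_cast
  constructor
  · rintro ⟨h1, h2, h3⟩
    have : 0 ≤ u * B := le_trans (by positivity) h1
    exact ⟨⟨by nlinarith, h2⟩, h1, h3⟩
  · rintro ⟨⟨_, h2⟩, h1, h3⟩
    exact ⟨h1, h2, h3⟩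

lemma SB_vol {b : ℕ} (hb : 2 ≤ b) (k : ℕ) {x y : ℝ} (hx : x ∈ Set.Icc (0 : ℝ) 1)
    (hy : y ∈ Set.Icc (0 : ℝ) 1) : volume.real (SB b k x y) = WB b k x y := by
  have hB : (0 : ℝ) < (b : ℝ) ^ k := by positivity
  set J : ℝ → ℕ → Set ℝ := fun x c => Set.Ico ((c : ℝ) / (b : ℝ) ^ k) (min x ((c + 1) / (b : ℝ) ^ k)) with hJ
  have hS : SB b k x y = ⋃ c ∈ Finset.range (b ^ k + 1), J x c ×ˢ J y c := by
    ext p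
    simp only [Set.mem_iUnion, Set.mem_prod, hJ, J_mem hB, SB, Set.mem_ofPred_eq, Finset.mem_range]
    constructor
    · rintro ⟨h1, h2, h3⟩
      have h0 : 0 ≤ ⌊(b : ℝ) ^ k * p.1⌋ := Int.floor_nonneg.2 (mul_nonneg hB.le h1.1)
      have h4 : ⌊(b : ℝ) ^ k * p.1⌋ < (b ^ k + 1 : ℕ) := by
        rw [Int.floor_lt]; push_cast
        nlinarith [h1.2, hx.2]
      refine ⟨⌊(b : ℝ) ^ k * p.1⌋.toNat, by omega, ⟨h1, by omega⟩, h2, by omega⟩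
    · rintro ⟨c, _, ⟨h1, h2⟩, h3, h4⟩
      exact ⟨h1, h3, h2.trans h4.symm⟩
  rw [hS, measureReal_biUnion_finset ?_ ?_ ?_]
  · unfold WB
    rw [← sum_cl (b ^ k + 1) (by nlinarith [hx.1]) (by nlinarith [hy.1])
      (by push_cast; nlinarith [hx.2]) (by push_cast; nlinarith [hy.2]), Finset.sum_div]
    apply Finset.sum_congr rfl
    intro c _
    rw [Measure.volume_eq_prod, measureReal_prod_prod, hJ, J_vol hB, J_vol hB]
    field_simp
  · intro c _ c' _ hcc
    apply Set.disjoint_left.2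
    intro p hp hp'
    simp only [Set.mem_prod, hJ, J_mem hB] at hp hp'
    apply hcc
    have := hp.1.2.symm.trans hp'.1.2
    exact_mod_cast this
  · intro c _
    exact measurableSet_Ico.prod measurableSet_Ico
  · intro c _
    rw [Measure.volume_eq_prod, Measure.prod_prod]
    exact ENNReal.mul_ne_top (by simp [hJ]) (by simp [hJ])

noncomputable def hB (b k : ℕ) (x y : ℝ) : ℝ × ℝ → ℝ :=
  (SB b k x y \ SB b (k + 1) x y).indicator fun _ => (b : ℝ) ^ (k + 1) / ((b : ℝ) - 1)

lemma hB_integral {b : ℕ} (hb : 2 ≤ b) (k : ℕ) {x y : ℝ} (hx : x ∈ Set.Icc (0 : ℝ) 1)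
    (hy : y ∈ Set.Icc (0 : ℝ) 1) : ∫ p, hB b k x y p = fB b k x y := by
  unfold hB
  rw [integral_indicator_const _ ((SB_meas _ _ _ _).diff (SB_meas _ _ _ _)),
    measureReal_sdiff' (SB_meas _ _ _ _) (SB_fin _ _ _ _) (SB_fin _ _ _ _), fB, ← SB_vol hb k hx hy, ← SB_vol hb (k + 1) hx hy, smul_eq_mul, mul_comm]
  · rw [Set.union_eq_self_of_subset_right]
    rintro p ⟨h1, h2, h3⟩
    exact ⟨h1, h2, floor_mono_pow hb (Nat.le_succ k) h3⟩

lemma hB_integrable (b k : ℕ) (x y : ℝ) : Integrable (hB b k x y) := by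
  unfold hB
  rw [integrable_indicator_iff ((SB_meas _ _ _ _).diff (SB_meas _ _ _ _))]
  exact integrableOn_const (ne_top_of_le_ne_top (SB_fin b k x y) (measure_mono Set.sdiff_subset))

lemma hB_apply {b : ℕ} (hb : 2 ≤ b) (k : ℕ) {x y : ℝ} (hx : x ∈ Set.Icc (0 : ℝ) 1)
    (hy : y ∈ Set.Icc (0 : ℝ) 1) (p : ℝ × ℝ) : hB b k x y p =
    if p.1 ∈ Set.Ico 0 x ∧ p.2 ∈ Set.Ico 0 y ∧ gammaB b p.1 p.2 = k then
      (b : ℝ) ^ (k + 1) / ((b : ℝ) - 1) else 0 := by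
  unfold hB
  rw [Set.indicator_apply]
  congr 1
  rw [eq_iff_iff]
  by_cases h1 : p.1 ∈ Set.Ico 0 x
  · by_cases h2 : p.2 ∈ Set.Ico 0 y
    · rw [gamma_iff hb ⟨h1.1, h1.2.trans_le hx.2⟩ ⟨h2.1, h2.2.trans_le hy.2⟩]
      simp only [Set.mem_sdiff, SB, Set.mem_ofPred_eq, h1, h2, true_and]
    · simp only [Set.mem_sdiff, SB, Set.mem_ofPred_eq, h2, false_and, and_false]
  · simp only [Set.mem_sdiff, SB, Set.mem_ofPred_eq, h1, false_and]

noncomputable def TT (n : ℕ) : Finset (Fin n × Fin n) := Finset.univ.filter fun q => q.2 ≠ q.1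

noncomputable def cB {n s : ℕ} (b : ℕ) (P : Fin n → Fin s → ℝ) (q : Fin n × Fin n) (r : Fin s) : ℕ :=
  (gammaB b (P q.1 r) (P q.2 r)).toNat

lemma gamma_ne_top {b : ℕ} {u v : ℝ} (h : u ≠ v) : gammaB b u v ≠ ⊤ := by
  unfold gammaB; rw [if_neg h]; exact ENat.natCast_ne_top _

lemma cB_spec {n s : ℕ} (b : ℕ) (P : Fin n → Fin s → ℝ)
    (hdist : ∀ j : Fin s, Function.Injective fun i => P i j) {q : Fin n × Fin n} (hq : q.2 ≠ q.1)
    (r : Fin s) : gammaB b (P q.1 r) (P q.2 r) = (cB b P q r : ℕ∞) := by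
  unfold cB
  rw [ENat.natCast_toNat]
  apply gamma_ne_top
  intro h
  exact hq (hdist r h).symm

lemma sum_pairs {n : ℕ} (A : Fin n × Fin n → Prop) (B : Fin n → Fin n → Prop)
    (h : ∀ q : Fin n × Fin n, q.2 ≠ q.1 → (A q ↔ B q.1 q.2)) :
    ((∑ l : Fin n, (Finset.univ.filter fun j : Fin n => j ≠ l ∧ B l j).card : ℕ) : ℝ) =
      ∑ q ∈ TT n, if A q then (1 : ℝ) else 0 := by
  unfold TT
  rw [Finset.sum_filter, Fintype.sum_prod_type]
  push_cast
  apply Finset.sum_congr rfl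
  intro l _
  rw [Finset.card_filter]
  push_cast
  apply Finset.sum_congr rfl
  intro j _
  by_cases hj : j = l
  · simp [hj]
  · have := h (l, j) hj
    simp [hj, this]

lemma MB_eq {n s : ℕ} (b : ℕ) (P : Fin n → Fin s → ℝ)
    (hdist : ∀ j : Fin s, Function.Injective fun i => P i j) (k : Fin s → ℕ) :
    (MB b P k : ℝ) = ∑ q ∈ TT n, if ∀ r, k r ≤ cB b P q r then (1 : ℝ) else 0 := by
  unfold MB mB
  convert sum_pairs (fun q => ∀ r, k r ≤ cB b P q r)
    (fun l j => ∀ r : Fin s, (k r : ℕ∞) ≤ gammaB b (P l r) (P j r)) ?_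
  intro q hq
  apply forall_congr'
  intro r
  rw [cB_spec b P hdist hq, Nat.cast_le]

lemma NB_eq {n s : ℕ} (b : ℕ) (P : Fin n → Fin s → ℝ)
    (hdist : ∀ j : Fin s, Function.Injective fun i => P i j) (k : Fin s → ℕ) :
    (NB b P k : ℝ) = ∑ q ∈ TT n, if ∀ r, k r = cB b P q r then (1 : ℝ) else 0 := by
  unfold NB nB
  convert sum_pairs (fun q => ∀ r, k r = cB b P q r)
    (fun l j => ∀ r : Fin s, gammaB b (P l r) (P j r) = (k r : ℕ∞)) ?_
  intro q hq
  apply forall_congr'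
  intro r
  rw [cB_spec b P hdist hq, Nat.cast_inj, eq_comm]

lemma psi_eq {n s b : ℕ} (hb : 2 ≤ b) (P : Fin n → Fin s → ℝ)
    (hdist : ∀ j : Fin s, Function.Injective fun i => P i j) (x y : Fin s → ℝ)
    (hx : ∀ j, x j ∈ Set.Icc (0 : ℝ) 1) (hy : ∀ j, y j ∈ Set.Icc (0 : ℝ) 1)
    (p : (Fin s → ℝ) × (Fin s → ℝ)) :
    (Rset s x y).indicator (fun p => psi b P p.1 p.2) p =
      (∑ q ∈ TT n, ∏ r, hB b (cB b P q r) (x r) (y r) (p.1 r, p.2 r)) / ((n : ℝ) * ((n : ℝ) - 1)) := by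
  have hb1 : (b : ℝ) - 1 ≠ 0 := by
    have : (2 : ℝ) ≤ b := by exact_mod_cast hb
    intro h; linarith
  have hmem : p ∈ Rset s x y ↔ ∀ r, p.1 r ∈ Set.Ico 0 (x r) ∧ p.2 r ∈ Set.Ico 0 (y r) := by
    unfold Rset
    rw [Set.mem_prod, Set.mem_univ_pi, Set.mem_univ_pi, forall_and]
  simp only [hB_apply hb _ (hx _) (hy _), Finset.prod_ite_zero, Finset.mem_univ, true_imp_iff]
  by_cases hp : p ∈ Rset s x y
  · rw [Set.indicator_of_mem hp]
    rw [hmem] at hp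
    simp only [(hp _).1, (hp _).2, true_and]
    unfold psi
    split_ifs with h
    · have hg : ∀ r, gammaB b (p.1 r) (p.2 r) = ((gammaB b (p.1 r) (p.2 r)).toNat : ℕ∞) :=
        fun r => (ENat.natCast_toNat (h r)).symm
      rw [NB_eq b P hdist, Finset.sum_mul, ← div_div, Finset.sum_div]
      congr 1
      apply Finset.sum_congr rfl
      intro q _
      have hiff : (∀ r, (gammaB b (p.1 r) (p.2 r)).toNat = cB b P q r) ↔
          ∀ r, gammaB b (p.1 r) (p.2 r) = (cB b P q r : ℕ∞) := by
        apply forall_congr'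
        intro r
        rw [hg r, Nat.cast_inj, ENat.toNat_natCast]
      by_cases hc : ∀ r, gammaB b (p.1 r) (p.2 r) = (cB b P q r : ℕ∞)
      · rw [if_pos hc, if_pos (hiff.2 hc), Finset.prod_div_distrib, Finset.prod_pow_eq_pow_sum,
          Finset.sum_add_distrib]
        simp only [hiff.2 hc]
        simp [add_comm]
      · rw [if_neg hc, if_neg (fun h' => hc (hiff.1 h'))]
        simp
    · rw [Finset.sum_eq_zero, zero_div]
      intro q _
      rw [if_neg]
      intro h'
      exact h fun r => by rw [h' r]; exact ENat.natCast_ne_top _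
  · rw [Set.indicator_of_notMem hp, Finset.sum_eq_zero, zero_div]
    intro q _
    rw [if_neg]
    intro h'
    exact hp (hmem.2 fun r => ⟨(h' r).1, (h' r).2.1⟩)

lemma psi_integral {n s b : ℕ} (hb : 2 ≤ b) (P : Fin n → Fin s → ℝ)
    (hdist : ∀ j : Fin s, Function.Injective fun i => P i j) (x y : Fin s → ℝ)
    (hx : ∀ j, x j ∈ Set.Icc (0 : ℝ) 1) (hy : ∀ j, y j ∈ Set.Icc (0 : ℝ) 1) :
    (∫ p in Rset s x y, psi b P p.1 p.2) =
      (∑ q ∈ TT n, ∏ r, fB b (cB b P q r) (x r) (y r)) / ((n : ℝ) * ((n : ℝ) - 1)) := by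
  have hR : MeasurableSet (Rset s x y) :=
    (MeasurableSet.univ_pi fun _ => measurableSet_Ico).prod
      (MeasurableSet.univ_pi fun _ => measurableSet_Ico)
  rw [← integral_indicator hR]
  simp_rw [psi_eq hb P hdist x y hx hy]
  rw [← (volume_measurePreserving_arrowProdEquivProdArrow ℝ ℝ (Fin s)).integral_comp']
  rw [integral_div]
  congr 1
  have e : ∀ (p : Fin s → ℝ × ℝ) r, (((MeasurableEquiv.arrowProdEquivProdArrow ℝ ℝ (Fin s)) p).1 r,
    ((MeasurableEquiv.arrowProdEquivProdArrow ℝ ℝ (Fin s)) p).2 r) = p r := fun p r => rfl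
  simp_rw [e]
  rw [integral_finsetSum]
  · apply Finset.sum_congr rfl
    intro q _
    rw [integral_fintype_prod_volume_eq_prod (fun r => hB b (cB b P q r) (x r) (y r))]
    exact Finset.prod_congr rfl fun r _ => hB_integral hb _ (hx r) (hy r)
  · intro q _
    exact Integrable.fintype_prod (f := fun r => hB b (cB b P q r) (x r) (y r))
      fun r => hB_integrable _ _ _ _

noncomputable def dB (b : ℕ) (x y : ℝ) : ℕ → ℝ
  | 0 => fB b 0 x y
  | (k + 1) => fB b (k + 1) x y - fB b k x y

lemma WB_mono {b : ℕ} (hb : 2 ≤ b) (k : ℕ) (x y : ℝ) : WB b k x y ≤ b * WB b (k + 1) x y := by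
  have hb0 : (0 : ℝ) < b := by positivity
  have h := G_grow hb ((b : ℝ) ^ k * x) ((b : ℝ) ^ k * y)
  unfold WB
  rw [pow_succ' (b : ℝ) k, mul_assoc, mul_assoc, ← mul_div_assoc, div_le_div_iff₀ (by positivity) (by positivity)]
  have := mul_le_mul_of_nonneg_left h (by positivity : (0 : ℝ) ≤ b * (b ^ k) ^ 2)
  nlinarith

lemma WB_convex {b : ℕ} (hb : 2 ≤ b) (k : ℕ) (x y : ℝ) :
    WB b k x y - WB b (k + 1) x y ≤ b * (WB b (k + 1) x y - WB b (k + 2) x y) := by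
  have hb0 : (0 : ℝ) < b := by positivity
  have h := G_convex hb ((b : ℝ) ^ k * x) ((b : ℝ) ^ k * y)
  have e0 : G ((b : ℝ) ^ k * x) ((b : ℝ) ^ k * y) = (b ^ k) ^ 2 * WB b k x y := by
    unfold WB; field_simp
  have e1 : G (b * ((b : ℝ) ^ k * x)) (b * ((b : ℝ) ^ k * y)) = (b ^ k) ^ 2 * b ^ 2 * WB b (k + 1) x y := by
    unfold WB; rw [pow_succ' (b : ℝ) k, mul_assoc, mul_assoc]; field_simp
  have e2 : G (b * (b * ((b : ℝ) ^ k * x))) (b * (b * ((b : ℝ) ^ k * y))) =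
      (b ^ k) ^ 2 * b ^ 4 * WB b (k + 2) x y := by
    unfold WB; rw [pow_succ' (b : ℝ) (k + 1), pow_succ' (b : ℝ) k, mul_assoc, mul_assoc, mul_assoc, mul_assoc]; field_simp
  rw [e0, e1, e2] at h
  have hc : (0 : ℝ) < (b ^ k) ^ 2 * b ^ 3 := by positivity
  refine le_of_mul_le_mul_left ?_ hc
  nlinarith

lemma dB_nonneg {b : ℕ} (hb : 2 ≤ b) {x y : ℝ} (hx : x ∈ Set.Icc (0 : ℝ) 1)
    (hy : y ∈ Set.Icc (0 : ℝ) 1) (k : ℕ) : 0 ≤ dB b x y k := by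
  have hb1 : (0 : ℝ) < (b : ℝ) - 1 := by
    have : (2 : ℝ) ≤ b := by exact_mod_cast hb
    linarith
  have hb0 : (0 : ℝ) < b := by positivity
  cases k with
  | zero =>
    show 0 ≤ fB b 0 x y
    rw [← hB_integral hb 0 hx hy]
    apply integral_nonneg
    intro p
    unfold hB
    apply Set.indicator_nonneg
    intro _ _
    positivity
  | succ k =>
    show 0 ≤ fB b (k + 1) x y - fB b k x y
    have h := WB_convex hb k x y
    unfold fB
    have : (b : ℝ) ^ (k + 1 + 1) / ((b : ℝ) - 1) * (WB b (k + 1) x y - WB b (k + 1 + 1) x y) -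
      (b : ℝ) ^ (k + 1) / ((b : ℝ) - 1) * (WB b k x y - WB b (k + 1) x y) =
      (b : ℝ) ^ (k + 1) / ((b : ℝ) - 1) * (b * (WB b (k + 1) x y - WB b (k + 2) x y) -
        (WB b k x y - WB b (k + 1) x y)) := by ring
    rw [this]
    apply mul_nonneg (by positivity)
    linarith

lemma dB_sum (b : ℕ) (x y : ℝ) (i : ℕ) : ∑ k ∈ Finset.range (i + 1), dB b x y k = fB b i x y := by
  induction i with
  | zero => simp [dB]
  | succ i ih => rw [Finset.sum_range_succ, ih]; simp [dB]

lemma WB_zero (b : ℕ) {x y : ℝ} (hx : x ∈ Set.Icc (0 : ℝ) 1)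
    (hy : y ∈ Set.Icc (0 : ℝ) 1) : WB b 0 x y = x * y := by
  unfold WB
  simp only [pow_zero, one_mul, one_pow, div_one]
  wlog h : x ≤ y generalizing x y
  · rw [G_symm, mul_comm]; exact this hy hx (by linarith)
  rcases hx.2.lt_or_eq with h1 | rfl
  · rcases hy.2.lt_or_eq with h2 | rfl
    · simpa using G_same (f := 0) hx.1 h1 hy.1 h2
    · rw [G_diff, mul_one]
      rw [Int.floor_one, Int.floor_lt]; simpa using h1
  · have : y = 1 := le_antisymm hy.2 h
    subst this
    simp [G]

lemma dB_wsum {b : ℕ} (hb : 2 ≤ b) (x y : ℝ) (K : ℕ) :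
    ∑ k ∈ Finset.range (K + 1), ((b : ℝ) ^ k)⁻¹ * dB b x y k =
      WB b 0 x y - WB b K x y + b / ((b : ℝ) - 1) * (WB b K x y - WB b (K + 1) x y) := by
  have hb1 : (0 : ℝ) < (b : ℝ) - 1 := by
    have : (2 : ℝ) ≤ b := by exact_mod_cast hb
    linarith
  have hb0 : (0 : ℝ) < b := by positivity
  induction K with
  | zero => simp [dB, fB]
  | succ K ih =>
    rw [Finset.sum_range_succ, ih]
    simp only [dB, fB]
    field_simp
    ring

lemma dB_wsum_le {b : ℕ} (hb : 2 ≤ b) {x y : ℝ} (hx : x ∈ Set.Icc (0 : ℝ) 1)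
    (hy : y ∈ Set.Icc (0 : ℝ) 1) (K : ℕ) :
    ∑ k ∈ Finset.range (K + 1), ((b : ℝ) ^ k)⁻¹ * dB b x y k ≤ x * y := by
  have hb1 : (0 : ℝ) < (b : ℝ) - 1 := by
    have : (2 : ℝ) ≤ b := by exact_mod_cast hb
    linarith
  rw [dB_wsum hb, WB_zero b hx hy]
  have h := WB_mono hb K x y
  have : b / ((b : ℝ) - 1) * (WB b K x y - WB b (K + 1) x y) ≤ WB b K x y := by
    rw [div_mul_eq_mul_div, div_le_iff₀ hb1]; linarith
  linarith

lemma fB_special {b : ℕ} (hb : 2 ≤ b) (k i : ℕ) :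
    fB b i ((b : ℝ) ^ k)⁻¹ ((b : ℝ) ^ k)⁻¹ = if k ≤ i then ((b : ℝ) ^ k)⁻¹ else 0 := by
  have hb2 : (2 : ℝ) ≤ b := by exact_mod_cast hb
  have hb1 : (0 : ℝ) < (b : ℝ) - 1 := by linarith
  have hb0 : (0 : ℝ) < b := by positivity
  have hW1 : ∀ j, k ≤ j → WB b j ((b : ℝ) ^ k)⁻¹ ((b : ℝ) ^ k)⁻¹ = ((b : ℝ) ^ k)⁻¹ * ((b : ℝ) ^ j)⁻¹ := by
    intro j hj
    obtain ⟨m, rfl⟩ := Nat.exists_eq_add_of_le hj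
    unfold WB
    have e : (b : ℝ) ^ (k + m) * ((b : ℝ) ^ k)⁻¹ = ((b ^ m : ℕ) : ℤ) + (0 : ℝ) := by
      push_cast; rw [pow_add]; field_simp; ring
    rw [e, G_same le_rfl one_pos le_rfl one_pos]
    push_cast
    rw [pow_add]; field_simp; ring
  have hW2 : ∀ j, j ≤ k → WB b j ((b : ℝ) ^ k)⁻¹ ((b : ℝ) ^ k)⁻¹ = ((b : ℝ) ^ k)⁻¹ * ((b : ℝ) ^ k)⁻¹ := by
    intro j hj
    rcases hj.lt_or_eq with hj | rfl
    · unfold WB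
      have h0 : (0 : ℝ) ≤ (b : ℝ) ^ j * ((b : ℝ) ^ k)⁻¹ := by positivity
      have h1 : (b : ℝ) ^ j * ((b : ℝ) ^ k)⁻¹ < 1 := by
        rw [← div_eq_mul_inv, div_lt_one (by positivity)]
        exact pow_lt_pow_right₀ (by linarith) hj
      have := G_same (f := 0) h0 h1 h0 h1
      simp only [Int.cast_zero, zero_add] at this
      rw [this]; field_simp
    · exact hW1 j le_rfl
  unfold fB
  split_ifs with h
  · rw [hW1 i h, hW1 (i + 1) (by omega), pow_succ]; field_simp
  · rw [hW2 i (by omega), hW2 (i + 1) (by omega)]; ring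

theorem stmt19 (b n s : ℕ) (hb : 2 ≤ b) (hs : 1 ≤ s) (hn : 2 ≤ n)
    (P : Fin n → Fin s → ℝ) (hP : ∀ i j, P i j ∈ Set.Ico (0 : ℝ) 1)
    (hdist : ∀ j : Fin s, Function.Injective fun i => P i j) :
    (∀ x y : Fin s → ℝ, (∀ j, x j ∈ Set.Icc (0 : ℝ) 1) → (∀ j, y j ∈ Set.Icc (0 : ℝ) 1) →
        (∫ p in Rset s x y, psi b P p.1 p.2) ≤ ∏ j, x j * y j) ↔
      ∀ k : Fin s → ℕ, CB b P k ≤ 1 := by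
  have hn2 : (2 : ℝ) ≤ n := by exact_mod_cast hn
  have hb2 : (2 : ℝ) ≤ b := by exact_mod_cast hb
  have hb0 : (0 : ℝ) < b := by positivity
  have hnn : (0 : ℝ) < (n : ℝ) * ((n : ℝ) - 1) := mul_pos (by linarith) (by linarith)
  constructor
  · intro H k
    have hx : ∀ j : Fin s, ((b : ℝ) ^ k j)⁻¹ ∈ Set.Icc (0 : ℝ) 1 := fun j =>
      ⟨by positivity, inv_le_one_of_one_le₀ (one_le_pow₀ (by linarith))⟩
    have h := H _ _ hx hx
    rw [psi_integral hb P hdist _ _ hx hx] at h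
    simp only [fB_special hb, Finset.prod_ite_zero, Finset.mem_univ, true_imp_iff] at h
    have e : ∑ q ∈ TT n, (if ∀ i, k i ≤ cB b P q i then ∏ i, ((b : ℝ) ^ k i)⁻¹ else 0) =
        (MB b P k : ℝ) * ∏ i, ((b : ℝ) ^ k i)⁻¹ := by
      rw [MB_eq b P hdist, Finset.sum_mul]
      exact Finset.sum_congr rfl fun q _ => by split_ifs <;> simp
    rw [e, Finset.prod_mul_distrib, Finset.prod_inv_distrib, Finset.prod_pow_eq_pow_sum,
      div_le_iff₀ hnn] at h
    unfold CB
    rw [div_le_one hnn]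
    have hB : (0 : ℝ) < (b : ℝ) ^ ∑ j, k j := by positivity
    have := mul_le_mul_of_nonneg_left h (by positivity : (0 : ℝ) ≤ ((b : ℝ) ^ ∑ j, k j) ^ 2)
    field_simp at this
    linarith
  · intro H x y hx hy
    rw [psi_integral hb P hdist _ _ hx hy, div_le_iff₀ hnn]
    obtain ⟨K, hK⟩ : ∃ K : ℕ, ∀ q r, cB b P q r ≤ K :=
      ⟨∑ q, ∑ r, cB b P q r, fun q r =>
        (Finset.single_le_sum (f := fun r => cB b P q r) (fun _ _ => Nat.zero_le _) (Finset.mem_univ r)).trans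
        (Finset.single_le_sum (f := fun q => ∑ r, cB b P q r) (fun _ _ => Nat.zero_le _) (Finset.mem_univ q))⟩
    set I := Fintype.piFinset fun _ : Fin s => Finset.range (K + 1) with hI
    have e1 : ∀ q, ∏ r, fB b (cB b P q r) (x r) (y r) =
        ∑ k ∈ I, (if ∀ r, k r ≤ cB b P q r then (1 : ℝ) else 0) * ∏ r, dB b (x r) (y r) (k r) := by
      intro q
      have : ∀ r, fB b (cB b P q r) (x r) (y r) =
          ∑ k ∈ Finset.range (K + 1), if k ≤ cB b P q r then dB b (x r) (y r) k else 0 := by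
        intro r
        rw [← dB_sum, ← Finset.sum_filter]
        apply Finset.sum_congr _ fun _ _ => rfl
        ext k
        have := hK q r
        simp only [Finset.mem_range, Finset.mem_filter]
        omega
      simp_rw [this]
      rw [Finset.prod_univ_sum]
      apply Finset.sum_congr rfl
      intro k _
      rw [Finset.prod_ite_zero]
      simp
    simp_rw [e1]
    rw [Finset.sum_comm]
    simp_rw [← Finset.sum_mul, ← MB_eq b P hdist]
    have hd : ∀ r k, 0 ≤ dB b (x r) (y r) k := fun r k => dB_nonneg hb (hx r) (hy r) k
    calc ∑ k ∈ I, (MB b P k : ℝ) * ∏ r, dB b (x r) (y r) (k r)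
        ≤ ∑ k ∈ I, ((n : ℝ) * ((n : ℝ) - 1)) * ∏ r, (((b : ℝ) ^ k r)⁻¹ * dB b (x r) (y r) (k r)) := by
          apply Finset.sum_le_sum
          intro k _
          have h := H k
          unfold CB at h
          rw [div_le_one hnn] at h
          rw [Finset.prod_mul_distrib, ← mul_assoc, Finset.prod_inv_distrib, Finset.prod_pow_eq_pow_sum]
          apply mul_le_mul_of_nonneg_right _ (Finset.prod_nonneg fun r _ => hd r _)
          rw [← div_eq_mul_inv, le_div_iff₀ (by positivity)]
          linarith
      _ = (∏ r, ∑ k ∈ Finset.range (K + 1), ((b : ℝ) ^ k)⁻¹ * dB b (x r) (y r) k) *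
            ((n : ℝ) * ((n : ℝ) - 1)) := by
          rw [Finset.prod_univ_sum, ← Finset.mul_sum, mul_comm]
      _ ≤ (∏ r, x r * y r) * ((n : ℝ) * ((n : ℝ) - 1)) := by
          apply mul_le_mul_of_nonneg_right _ hnn.le
          apply Finset.prod_le_prod
          · intro r _
            exact Finset.sum_nonneg fun k _ => mul_nonneg (by positivity) (hd r k)
          · intro r _
            exact dB_wsum_le hb (hx r) (hy r) K
end
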